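/- arXiv:1709.01368 — 6 statements merged into one kernel-verified Lean document; each statement's English description precedes it below -/
import Mathlib

section
/- Let (x*, y*) be an S-stationary point of the continuous reformulation with S-stationary multiplier (λ*, μ*, γ*). Then the CC-critical cone satisfies C_Z(x*,y*) = {(d_x, d_y) ∈ L_Z(x*,y*) : ∇gᵢ(x*)ᵀd_x = 0 for all i with gᵢ(x*) = 0 and λ*ᵢ > 0}. -/
open Set Filter Topology

noncomputable section

/-- Number of nonzero components of a vector (the "zero norm"). -/
def card0 {n : ℕ} (x : Fin n → ℝ) : ℕ := {i | x i ≠ 0}.ncard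

/-- First directional derivative `∇φ(x)ᵀd`. -/
def D1 {n : ℕ} (φ : (Fin n → ℝ) → ℝ) (x d : Fin n → ℝ) : ℝ := fderiv ℝ φ x d

/-- Second derivative quadratic form `dᵀ∇²φ(x)d`. -/
def D2 {n : ℕ} (φ : (Fin n → ℝ) → ℝ) (x d : Fin n → ℝ) : ℝ :=
  iteratedFDeriv ℝ 2 φ x ![d, d]

/-- Feasibility for the cardinality constrained problem (CCP):
`g(x) ≤ 0`, `h(x) = 0`, `‖x‖₀ ≤ κ`. -/
def CCPFeasible {n m p : ℕ} (g : (Fin n → ℝ) → Fin m → ℝ) (h : (Fin n → ℝ) → Fin p → ℝ)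
    (κ : ℕ) (x : Fin n → ℝ) : Prop :=
  (∀ i, g x i ≤ 0) ∧ (∀ i, h x i = 0) ∧ card0 x ≤ κ

/-- Feasible set `Z` of the continuous reformulation. -/
def ZSet {n m p : ℕ} (g : (Fin n → ℝ) → Fin m → ℝ) (h : (Fin n → ℝ) → Fin p → ℝ)
    (κ : ℕ) : Set ((Fin n → ℝ) × (Fin n → ℝ)) :=
  {z | (∀ i, g z.1 i ≤ 0) ∧ (∀ i, h z.1 i = 0) ∧ (∀ i, 0 ≤ z.2 i) ∧ (∀ i, z.2 i ≤ 1) ∧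
    ((n : ℝ) - (κ : ℝ) ≤ ∑ i, z.2 i) ∧ ∀ i, z.1 i * z.2 i = 0}

/-- `(lam, mu, gam)` is an M-stationary multiplier at `x`. -/
def IsMMult {n m p : ℕ} (f : (Fin n → ℝ) → ℝ) (g : (Fin n → ℝ) → Fin m → ℝ)
    (h : (Fin n → ℝ) → Fin p → ℝ) (x : Fin n → ℝ)
    (lam : Fin m → ℝ) (mu : Fin p → ℝ) (gam : Fin n → ℝ) : Prop :=
  (∀ d, D1 f x d + ∑ i, lam i * D1 (fun x' => g x' i) x d
      + ∑ i, mu i * D1 (fun x' => h x' i) x d + ∑ i, gam i * d i = 0) ∧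
  (∀ i, 0 ≤ lam i) ∧ (∀ i, lam i * g x i = 0) ∧ (∀ i, x i ≠ 0 → gam i = 0)

/-- `(lam, mu, gam)` is an S-stationary multiplier at `(x, y)`. -/
def IsSMult {n m p : ℕ} (f : (Fin n → ℝ) → ℝ) (g : (Fin n → ℝ) → Fin m → ℝ)
    (h : (Fin n → ℝ) → Fin p → ℝ) (x y : Fin n → ℝ)
    (lam : Fin m → ℝ) (mu : Fin p → ℝ) (gam : Fin n → ℝ) : Prop :=
  IsMMult f g h x lam mu gam ∧ ∀ i, x i = 0 → y i = 0 → gam i = 0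

/-- `z` is an M-stationary point of the continuous reformulation. -/
def MStationary {n m p : ℕ} (f : (Fin n → ℝ) → ℝ) (g : (Fin n → ℝ) → Fin m → ℝ)
    (h : (Fin n → ℝ) → Fin p → ℝ) (κ : ℕ) (z : (Fin n → ℝ) × (Fin n → ℝ)) : Prop :=
  z ∈ ZSet g h κ ∧ ∃ lam mu gam, IsMMult f g h z.1 lam mu gam

/-- `z` is an S-stationary point of the continuous reformulation. -/
def SStationary {n m p : ℕ} (f : (Fin n → ℝ) → ℝ) (g : (Fin n → ℝ) → Fin m → ℝ)
    (h : (Fin n → ℝ) → Fin p → ℝ) (κ : ℕ) (z : (Fin n → ℝ) × (Fin n → ℝ)) : Prop :=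
  z ∈ ZSet g h κ ∧ ∃ lam mu gam, IsSMult f g h z.1 z.2 lam mu gam

/-- CC-LICQ at `x`: the active gradients `∇gᵢ(x)` (`gᵢ(x) = 0`), all `∇hᵢ(x)`,
and the unit vectors `eᵢ` (`xᵢ = 0`) are linearly independent. -/
def CCLICQ {n m p : ℕ} (g : (Fin n → ℝ) → Fin m → ℝ) (h : (Fin n → ℝ) → Fin p → ℝ)
    (x : Fin n → ℝ) : Prop :=
  ∀ (lam : Fin m → ℝ) (mu : Fin p → ℝ) (gam : Fin n → ℝ),
    (∀ i, g x i ≠ 0 → lam i = 0) → (∀ i, x i ≠ 0 → gam i = 0) →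
    (∀ d, ∑ i, lam i * D1 (fun x' => g x' i) x d
        + ∑ i, mu i * D1 (fun x' => h x' i) x d + ∑ i, gam i * d i = 0) →
    lam = 0 ∧ mu = 0 ∧ gam = 0

/-- CC-MFCQ at `x`: the active gradients `∇gᵢ(x)` together with all `∇hᵢ(x)` and the
unit vectors `eᵢ` (`xᵢ = 0`) are positively linearly independent. -/
def CCMFCQ {n m p : ℕ} (g : (Fin n → ℝ) → Fin m → ℝ) (h : (Fin n → ℝ) → Fin p → ℝ)
    (x : Fin n → ℝ) : Prop :=
  ∀ (lam : Fin m → ℝ) (mu : Fin p → ℝ) (gam : Fin n → ℝ),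
    (∀ i, 0 ≤ lam i) → (∀ i, g x i ≠ 0 → lam i = 0) → (∀ i, x i ≠ 0 → gam i = 0) →
    (∀ d, ∑ i, lam i * D1 (fun x' => g x' i) x d
        + ∑ i, mu i * D1 (fun x' => h x' i) x d + ∑ i, gam i * d i = 0) →
    lam = 0 ∧ mu = 0 ∧ gam = 0

/-- The linear combination `Σ lamᵢ ∇gᵢ(x) + Σ muᵢ ∇hᵢ(x) + Σ gamᵢ eᵢ` vanishes. -/
def CombZero {n m p : ℕ} (g : (Fin n → ℝ) → Fin m → ℝ) (h : (Fin n → ℝ) → Fin p → ℝ)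
    (lam : Fin m → ℝ) (mu : Fin p → ℝ) (gam : Fin n → ℝ) (x : Fin n → ℝ) : Prop :=
  ∀ d, ∑ i, lam i * D1 (fun x' => g x' i) x d
      + ∑ i, mu i * D1 (fun x' => h x' i) x d + ∑ i, gam i * d i = 0

/-- CC-CPLD at `x`: whenever gradients indexed by subsets of the active sets are
positively linearly dependent at `x`, they remain linearly dependent nearby. -/
def CCCPLD {n m p : ℕ} (g : (Fin n → ℝ) → Fin m → ℝ) (h : (Fin n → ℝ) → Fin p → ℝ)
    (x : Fin n → ℝ) : Prop :=
  ∀ (I1 : Finset (Fin m)) (I2 : Finset (Fin p)) (I3 : Finset (Fin n)),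
    (∀ i ∈ I1, g x i = 0) → (∀ i ∈ I3, x i = 0) →
    (∃ lam mu gam, (∀ i, 0 ≤ lam i) ∧ (∀ i, i ∉ I1 → lam i = 0) ∧ (∀ i, i ∉ I2 → mu i = 0) ∧
      (∀ i, i ∉ I3 → gam i = 0) ∧ ¬(lam = 0 ∧ mu = 0 ∧ gam = 0) ∧ CombZero g h lam mu gam x) →
    ∀ᶠ x' in nhds x, ∃ lam mu gam, (∀ i, i ∉ I1 → lam i = 0) ∧ (∀ i, i ∉ I2 → mu i = 0) ∧
      (∀ i, i ∉ I3 → gam i = 0) ∧ ¬(lam = 0 ∧ mu = 0 ∧ gam = 0) ∧ CombZero g h lam mu gam x'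

/-- The CC-linearisation cone `L_Z(x, y)` (as a predicate on `(dx, dy)`). -/
def LinCone {n m p : ℕ} (g : (Fin n → ℝ) → Fin m → ℝ) (h : (Fin n → ℝ) → Fin p → ℝ)
    (κ : ℕ) (x y dx dy : Fin n → ℝ) : Prop :=
  (∀ i, g x i = 0 → D1 (fun x' => g x' i) x dx ≤ 0) ∧
  (∀ i, D1 (fun x' => h x' i) x dx = 0) ∧
  ((∑ i, y i = (n : ℝ) - (κ : ℝ)) → 0 ≤ ∑ i, dy i) ∧
  (∀ i, x i ≠ 0 → y i = 0 → dy i = 0) ∧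
  (∀ i, x i = 0 → y i = 0 → 0 ≤ dy i) ∧
  (∀ i, x i = 0 → y i = 1 → dy i ≤ 0) ∧
  (∀ i, x i = 0 → 0 < y i → dx i = 0) ∧
  (∀ i, x i = 0 → y i = 0 → dx i * dy i = 0)

/-- The CC-critical cone `C_Z(x, y)`. -/
def CritCone {n m p : ℕ} (f : (Fin n → ℝ) → ℝ) (g : (Fin n → ℝ) → Fin m → ℝ)
    (h : (Fin n → ℝ) → Fin p → ℝ) (κ : ℕ) (x y dx dy : Fin n → ℝ) : Prop :=
  LinCone g h κ x y dx dy ∧ D1 f x dx ≤ 0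

/-- The critical cone `C_X(x)` for the original cardinality constrained problem. -/
def CritConeX {n m p : ℕ} (f : (Fin n → ℝ) → ℝ) (g : (Fin n → ℝ) → Fin m → ℝ)
    (h : (Fin n → ℝ) → Fin p → ℝ) (κ : ℕ) (x dx : Fin n → ℝ) : Prop :=
  (∀ i, g x i = 0 → D1 (fun x' => g x' i) x dx ≤ 0) ∧
  (∀ i, D1 (fun x' => h x' i) x dx = 0) ∧
  (n - κ ≤ {i | x i = 0 ∧ dx i = 0}.ncard) ∧
  D1 f x dx ≤ 0

/-- `x` is a local minimum of the cardinality constrained problem. -/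
def LocalMinCCP {n m p : ℕ} (f : (Fin n → ℝ) → ℝ) (g : (Fin n → ℝ) → Fin m → ℝ)
    (h : (Fin n → ℝ) → Fin p → ℝ) (κ : ℕ) (x : Fin n → ℝ) : Prop :=
  CCPFeasible g h κ x ∧ ∃ r > (0 : ℝ), ∀ x', CCPFeasible g h κ x' → dist x' x < r → f x ≤ f x'

/-- `x` is a strict local minimum of the cardinality constrained problem. -/
def StrictLocalMinCCP {n m p : ℕ} (f : (Fin n → ℝ) → ℝ) (g : (Fin n → ℝ) → Fin m → ℝ)
    (h : (Fin n → ℝ) → Fin p → ℝ) (κ : ℕ) (x : Fin n → ℝ) : Prop :=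
  CCPFeasible g h κ x ∧
    ∃ r > (0 : ℝ), ∀ x', CCPFeasible g h κ x' → dist x' x < r → x' ≠ x → f x < f x'

/-- `z` is a local minimum of the continuous reformulation. -/
def LocalMinZ {n m p : ℕ} (f : (Fin n → ℝ) → ℝ) (g : (Fin n → ℝ) → Fin m → ℝ)
    (h : (Fin n → ℝ) → Fin p → ℝ) (κ : ℕ) (z : (Fin n → ℝ) × (Fin n → ℝ)) : Prop :=
  z ∈ ZSet g h κ ∧ ∃ r > (0 : ℝ), ∀ z' ∈ ZSet g h κ, dist z' z < r → f z.1 ≤ f z'.1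

/-- `z` is a strict local minimum with respect to `x` of the continuous reformulation. -/
def StrictLocalMinX {n m p : ℕ} (f : (Fin n → ℝ) → ℝ) (g : (Fin n → ℝ) → Fin m → ℝ)
    (h : (Fin n → ℝ) → Fin p → ℝ) (κ : ℕ) (z : (Fin n → ℝ) × (Fin n → ℝ)) : Prop :=
  z ∈ ZSet g h κ ∧
    ∃ r > (0 : ℝ), ∀ z' ∈ ZSet g h κ, dist z' z < r → z'.1 ≠ z.1 → f z.1 < f z'.1

/-- Feasible set `Z(t)` of the Scholtes-type regularized program NLP(t). -/
def ZReg {n m p : ℕ} (g : (Fin n → ℝ) → Fin m → ℝ) (h : (Fin n → ℝ) → Fin p → ℝ)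
    (κ : ℕ) (t : ℝ) : Set ((Fin n → ℝ) × (Fin n → ℝ)) :=
  {z | (∀ i, g z.1 i ≤ 0) ∧ (∀ i, h z.1 i = 0) ∧ (∀ i, 0 ≤ z.2 i) ∧ (∀ i, z.2 i ≤ 1) ∧
    ((n : ℝ) - (κ : ℝ) ≤ ∑ i, z.2 i) ∧ (∀ i, z.1 i * z.2 i ≤ t) ∧ ∀ i, -t ≤ z.1 i * z.2 i}

/-- `z` is a local minimum of the regularized program NLP(t). -/
def LocalMinReg {n m p : ℕ} (f : (Fin n → ℝ) → ℝ) (g : (Fin n → ℝ) → Fin m → ℝ)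
    (h : (Fin n → ℝ) → Fin p → ℝ) (κ : ℕ) (t : ℝ) (z : (Fin n → ℝ) × (Fin n → ℝ)) : Prop :=
  z ∈ ZReg g h κ t ∧ ∃ r > (0 : ℝ), ∀ z' ∈ ZReg g h κ t, dist z' z < r → f z.1 ≤ f z'.1

/-- `z` is a KKT point of the regularized program NLP(t). -/
def KKTReg {n m p : ℕ} (f : (Fin n → ℝ) → ℝ) (g : (Fin n → ℝ) → Fin m → ℝ)
    (h : (Fin n → ℝ) → Fin p → ℝ) (κ : ℕ) (t : ℝ) (z : (Fin n → ℝ) × (Fin n → ℝ)) : Prop :=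
  z ∈ ZReg g h κ t ∧
  ∃ (lam : Fin m → ℝ) (mu : Fin p → ℝ) (nu0 nu1 : Fin n → ℝ) (rho : ℝ) (dpl dmi : Fin n → ℝ),
    (∀ d : Fin n → ℝ, D1 f z.1 d + ∑ i, lam i * D1 (fun x' => g x' i) z.1 d
        + ∑ i, mu i * D1 (fun x' => h x' i) z.1 d
        + ∑ i, (dpl i - dmi i) * z.2 i * d i = 0) ∧
    (∀ i, -nu0 i + nu1 i - rho + (dpl i - dmi i) * z.1 i = 0) ∧
    (∀ i, 0 ≤ lam i) ∧ (∀ i, 0 ≤ nu0 i) ∧ (∀ i, 0 ≤ nu1 i) ∧ 0 ≤ rho ∧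
    (∀ i, 0 ≤ dpl i) ∧ (∀ i, 0 ≤ dmi i) ∧
    (∀ i, lam i * g z.1 i = 0) ∧ (∀ i, nu0 i * z.2 i = 0) ∧ (∀ i, nu1 i * (z.2 i - 1) = 0) ∧
    rho * (∑ i, z.2 i - ((n : ℝ) - (κ : ℝ))) = 0 ∧
    (∀ i, dpl i * (z.1 i * z.2 i - t) = 0) ∧ (∀ i, dmi i * (z.1 i * z.2 i + t) = 0)

/-- Standard MFCQ for the regularized program NLP(t) at a feasible point `z`. -/
def MFCQReg {n m p : ℕ} (g : (Fin n → ℝ) → Fin m → ℝ) (h : (Fin n → ℝ) → Fin p → ℝ)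
    (κ : ℕ) (t : ℝ) (z : (Fin n → ℝ) × (Fin n → ℝ)) : Prop :=
  (∀ mu : Fin p → ℝ, (∀ d, ∑ i, mu i * D1 (fun x' => h x' i) z.1 d = 0) → mu = 0) ∧
  ∃ dx dy : Fin n → ℝ,
    (∀ i, D1 (fun x' => h x' i) z.1 dx = 0) ∧
    (∀ i, g z.1 i = 0 → D1 (fun x' => g x' i) z.1 dx < 0) ∧
    (∀ i, z.2 i = 0 → 0 < dy i) ∧
    (∀ i, z.2 i = 1 → dy i < 0) ∧
    (∑ i, z.2 i = (n : ℝ) - (κ : ℝ) → 0 < ∑ i, dy i) ∧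
    (∀ i, z.1 i * z.2 i = t → z.2 i * dx i + z.1 i * dy i < 0) ∧
    (∀ i, z.1 i * z.2 i = -t → 0 < z.2 i * dx i + z.1 i * dy i)

/-- Along the CC-linearisation cone only the inequality multipliers of an S-stationary point
contribute to the Lagrangian derivative. -/
theorem LinCone.D1_add_sum_eq_zero {n m p : ℕ} {f : (Fin n → ℝ) → ℝ}
    {g : (Fin n → ℝ) → Fin m → ℝ} {h : (Fin n → ℝ) → Fin p → ℝ} {κ : ℕ}
    {x y dx dy : Fin n → ℝ} {lam : Fin m → ℝ} {mu : Fin p → ℝ} {gam : Fin n → ℝ}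
    (hL : LinCone g h κ x y dx dy) (hS : IsSMult f g h x y lam mu gam) (hy : ∀ i, 0 ≤ y i) :
    D1 f x dx + ∑ i, lam i * D1 (fun x' => g x' i) x dx = 0 := by
  obtain ⟨⟨hlag, -, -, hgam⟩, hgam0⟩ := hS
  obtain ⟨-, hh, -, -, -, -, hdx, -⟩ := hL
  have hmu : ∑ i, mu i * D1 (fun x' => h x' i) x dx = 0 :=
    Finset.sum_eq_zero fun i _ => by rw [hh i, mul_zero]
  have hgamdx : ∑ i, gam i * dx i = 0 := by
    refine Finset.sum_eq_zero fun i _ => ?_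
    by_cases hx : x i = 0
    · rcases (hy i).eq_or_lt with hyi | hyi
      · rw [hgam0 i hx hyi.symm, zero_mul]
      · rw [hdx i hx hyi, mul_zero]
    · rw [hgam i hx, zero_mul]
  simpa only [hmu, hgamdx, add_zero] using hlag dx

/-- Along the CC-linearisation cone each weighted inequality derivative is nonpositive. -/
theorem LinCone.mul_D1_nonpos {n m p : ℕ} {f : (Fin n → ℝ) → ℝ}
    {g : (Fin n → ℝ) → Fin m → ℝ} {h : (Fin n → ℝ) → Fin p → ℝ} {κ : ℕ}
    {x y dx dy : Fin n → ℝ} {lam : Fin m → ℝ} {mu : Fin p → ℝ} {gam : Fin n → ℝ}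
    (hL : LinCone g h κ x y dx dy) (hM : IsMMult f g h x lam mu gam) (i : Fin m) :
    lam i * D1 (fun x' => g x' i) x dx ≤ 0 := by
  rcases mul_eq_zero.mp (hM.2.2.1 i) with hi | hi
  · rw [hi, zero_mul]
  · exact mul_nonpos_of_nonneg_of_nonpos (hM.2.1 i) (hL.1 i hi)

theorem stmt2
    {n m p : ℕ} (f : (Fin n → ℝ) → ℝ) (g : (Fin n → ℝ) → Fin m → ℝ)
    (h : (Fin n → ℝ) → Fin p → ℝ) (κ : ℕ)
    (hn : 0 < n) (hm : 0 < m) (hp : 0 < p) (hκ0 : 0 < κ) (hκn : κ < n)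
    (hf : ContDiff ℝ 1 f) (hg : ∀ i, ContDiff ℝ 1 (fun x => g x i))
    (hh : ∀ i, ContDiff ℝ 1 (fun x => h x i))
    (xs ys : Fin n → ℝ) (hZ : (xs, ys) ∈ ZSet g h κ)
    (lam : Fin m → ℝ) (mu : Fin p → ℝ) (gam : Fin n → ℝ)
    (hS : IsSMult f g h xs ys lam mu gam) :
    ∀ dx dy : Fin n → ℝ,
      CritCone f g h κ xs ys dx dy ↔
        (LinCone g h κ xs ys dx dy ∧
          ∀ i, g xs i = 0 → 0 < lam i → D1 (fun x' => g x' i) xs dx = 0) := by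
  intro dx dy
  refine and_congr_right fun hL => ?_
  have hsum := hL.D1_add_sum_eq_zero hS hZ.2.2.1
  have hterm := hL.mul_D1_nonpos hS.1
  constructor
  · intro hfd i _ hpos
    have hzero : ∑ i, lam i * D1 (fun x' => g x' i) xs dx = 0 :=
      le_antisymm (Finset.sum_nonpos fun i _ => hterm i) (by linarith)
    have hi := (Finset.sum_eq_zero_iff_of_nonpos fun i _ => hterm i).mp hzero i
      (Finset.mem_univ i)
    exact (mul_eq_zero.mp hi).resolve_left hpos.ne'
  · intro hact
    have hzero : ∑ i, lam i * D1 (fun x' => g x' i) xs dx = 0 := by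
      refine Finset.sum_eq_zero fun i _ => ?_
      rcases (hS.1.2.1 i).eq_or_lt with hi | hi
      · rw [← hi, zero_mul]
      · have hg0 := (mul_eq_zero.mp (hS.1.2.2.1 i)).resolve_left hi.ne'
        rw [hact i hg0 hi, mul_zero]
    linarith
end
end

section
/- Let g and h be twice continuously differentiable, let (x*, y*) be an S-stationary point of the continuous reformulation with multiplier (λ*, μ*, γ*) at which CC-LICQ holds, and let (d_x, d_y) ∈ C_Z(x*,y*). Then there exist ε > 0 and a twice continuously differentiable curve ξ : (−ε, ε) → ℝ^n with ξ(0) = x*, ξ'(0) = d_x, such that for all t ∈ [0, ε): (ξ(t), y*) ∈ Z, gᵢ(ξ(t)) = 0 for all i with gᵢ(x*) = 0 and λ*ᵢ > 0, and ξᵢ(t) = 0 for all i with x*ᵢ = 0 and y*ᵢ > 0. -/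
open Set Filter Topology

noncomputable section

/-- A linear map into a finite power of `ℝ` whose components are linearly independent
is surjective. -/
theorem range_eq_top_of_components_independent {E K : Type*} [AddCommGroup E] [Module ℝ E]
    [Fintype K] (B : E →ₗ[ℝ] K → ℝ)
    (hB : ∀ c : K → ℝ, (∀ v, ∑ k, c k * B v k = 0) → c = 0) : LinearMap.range B = ⊤ := by
  classical
  by_contra hne
  obtain ⟨φ, hφ0, hφ⟩ := Submodule.exists_le_ker_of_lt_top _ (lt_top_iff_ne_top.2 hne)
  have hφ_apply (w : K → ℝ) : φ w = ∑ k, φ (Pi.single k 1) * w k := by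
    conv_lhs => rw [pi_eq_sum_univ' w]
    simp [mul_comm, Pi.single]
  have hc := hB (fun k => φ (Pi.single k 1)) fun v => by
    rw [← hφ_apply]
    exact hφ ⟨v, rfl⟩
  refine hφ0 (LinearMap.ext fun w => ?_)
  rw [hφ_apply]
  simpa using Finset.sum_eq_zero fun k _ => by rw [congrFun hc k, Pi.zero_apply, zero_mul]

/-- If `F` is `C^r` near a zero `a` with surjective derivative `B`, then for every direction `d`
there is a `C^r` curve through `a` with velocity `d` along which `F` equals `t • B d`. -/
theorem exists_curve_of_range_eq_top {E W : Type*} [NormedAddCommGroup E] [NormedSpace ℝ E]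
    [CompleteSpace E] [NormedAddCommGroup W] [NormedSpace ℝ W] [FiniteDimensional ℝ W]
    {r : WithTop ℕ∞} (hr : r ≠ 0) {F : E → W} {B : E →L[ℝ] W} {a : E}
    (hF : ContDiffAt ℝ r F a) (hB : HasFDerivAt F B a) (ha : F a = 0)
    (hsurj : LinearMap.range (B : E →ₗ[ℝ] W) = ⊤) (d : E) :
    ∃ ξ : ℝ → E, ContDiffAt ℝ r ξ 0 ∧ ξ 0 = a ∧ HasDerivAt ξ d 0 ∧
      ∀ᶠ t in 𝓝 (0 : ℝ), F (ξ t) = t • B d := by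
  obtain ⟨R₀, hR₀⟩ := LinearMap.exists_rightInverse_of_surjective _ hsurj
  let R : W →L[ℝ] E := LinearMap.toContinuousLinearMap R₀
  have hBR (w : W) : B (R w) = w := LinearMap.congr_fun hR₀ w
  let G : E → E := fun x => (x - a) + R (F x - B (x - a))
  have hGa : G a = 0 := by simp [G, ha]
  have hG : ContDiffAt ℝ r G a := by
    have hsub : ContDiffAt ℝ r (fun x : E => x - a) a := contDiffAt_id.sub contDiffAt_const
    exact hsub.add (R.contDiff.contDiffAt.comp a
      (hF.sub (B.contDiff.contDiffAt.comp a hsub)))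
  have hG' : HasFDerivAt G (ContinuousLinearEquiv.refl ℝ E : E →L[ℝ] E) a := by
    have hsub : HasFDerivAt (fun x : E => x - a) (ContinuousLinearMap.id ℝ E) a :=
      (hasFDerivAt_id a).sub_const a
    have key := hsub.add (R.hasFDerivAt.comp a (hB.sub (B.hasFDerivAt.comp a hsub)))
    convert! key using 1
    ext v
    simp
  have hstrict := hG.hasStrictFDerivAt' hG' hr
  let H : E → E := hG.localInverse hG' hr
  have hH0 : H 0 = a := by
    have := hG.localInverse_apply_image hG' hr
    rwa [hGa] at this
  have hHr : ContDiffAt ℝ r H 0 := by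
    have := hG.to_localInverse hG' hr
    rwa [hGa] at this
  have hH' : HasFDerivAt H (ContinuousLinearMap.id ℝ E) 0 := by
    have := hstrict.to_localInverse.hasFDerivAt
    rwa [hGa] at this
  have hGH : ∀ᶠ y in 𝓝 (0 : E), G (H y) = y := by
    have := hstrict.eventually_right_inverse
    rwa [hGa] at this
  have hline : HasDerivAt (fun t : ℝ => t • d) d 0 := by
    simpa using (hasDerivAt_id (0 : ℝ)).smul_const d
  have hline0 : (0 : ℝ) • d = 0 := zero_smul ℝ d
  refine ⟨fun t => H (t • d), ?_, by simp [hH0], ?_, ?_⟩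
  · exact ContDiffAt.comp (g := H) (0 : ℝ) (by rwa [hline0])
      (contDiffAt_id.smul contDiffAt_const)
  · exact HasFDerivAt.comp_hasDerivAt (l := H) (0 : ℝ) (by rwa [hline0]) hline
  · have htend : Tendsto (fun t : ℝ => t • d) (𝓝 0) (𝓝 0) := by
      simpa using hline.continuousAt.tendsto
    filter_upwards [htend.eventually hGH] with t ht
    have := congrArg B ht
    simpa [G, hBR] using this

theorem stmt3
    {n m p : ℕ} (f : (Fin n → ℝ) → ℝ) (g : (Fin n → ℝ) → Fin m → ℝ)
    (h : (Fin n → ℝ) → Fin p → ℝ) (κ : ℕ)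
    (hn : 0 < n) (hm : 0 < m) (hp : 0 < p) (hκ0 : 0 < κ) (hκn : κ < n)
    (hf : ContDiff ℝ 1 f) (hg : ∀ i, ContDiff ℝ 2 (fun x => g x i))
    (hh : ∀ i, ContDiff ℝ 2 (fun x => h x i))
    (xs ys : Fin n → ℝ) (hZ : (xs, ys) ∈ ZSet g h κ)
    (lam : Fin m → ℝ) (mu : Fin p → ℝ) (gam : Fin n → ℝ)
    (hS : IsSMult f g h xs ys lam mu gam) (hlicq : CCLICQ g h xs)
    (dx dy : Fin n → ℝ) (hd : CritCone f g h κ xs ys dx dy) :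
    ∃ ε > (0 : ℝ), ∃ ξ : ℝ → (Fin n → ℝ),
      ContDiffOn ℝ 2 ξ (Ioo (-ε) ε) ∧ ξ 0 = xs ∧ HasDerivAt ξ dx 0 ∧
      ∀ t ∈ Ico (0 : ℝ) ε,
        (ξ t, ys) ∈ ZSet g h κ ∧
        (∀ i, g xs i = 0 → 0 < lam i → g (ξ t) i = 0) ∧
        (∀ i, xs i = 0 → 0 < ys i → ξ t i = 0) := by
  classical
  obtain ⟨hg_le, hh_zero, hy0, hy1, hysum, hxy⟩ := hZ
  obtain ⟨⟨hstat, hlam, hcompl, hgam⟩, hgam0⟩ := hS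
  obtain ⟨⟨hdg, hdh, -, -, -, -, hdx, -⟩, hdf⟩ := hd
  have hxs_of_pos (i : Fin n) (hi : 0 < ys i) : xs i = 0 :=
    (mul_eq_zero.1 (hxy i)).resolve_right hi.ne'
  have hgam_dx (i : Fin n) : gam i * dx i = 0 := by
    by_cases hx : xs i = 0
    · rcases (hy0 i).eq_or_lt with hy | hy
      · rw [hgam0 i hx hy.symm, zero_mul]
      · rw [hdx i hx hy, mul_zero]
    · rw [hgam i hx, zero_mul]
  have hterm (i : Fin m) : lam i * D1 (fun x' => g x' i) xs dx ≤ 0 := by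
    by_cases hgi : g xs i = 0
    · exact mul_nonpos_of_nonneg_of_nonpos (hlam i) (hdg i hgi)
    · rw [(mul_eq_zero.1 (hcompl i)).resolve_right hgi, zero_mul]
  have hlam_dx (i : Fin m) : lam i * D1 (fun x' => g x' i) xs dx = 0 := by
    have hsum := hstat dx
    simp only [hdh, mul_zero, hgam_dx, Finset.sum_const_zero, add_zero] at hsum
    have hzero : ∑ i, lam i * D1 (fun x' => g x' i) xs dx = 0 :=
      le_antisymm (Finset.sum_nonpos fun i _ => hterm i) (by linarith)
    exact (Finset.sum_eq_zero_iff_of_nonpos fun i _ => hterm i).1 hzero i (Finset.mem_univ i)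
  let F : (Fin n → ℝ) → ({i // g xs i = 0} ⊕ Fin p ⊕ {i // xs i = 0}) → ℝ := fun x =>
    Sum.elim (fun i => g x i) (Sum.elim (fun i => h x i) fun i => x i)
  have hF : ContDiff ℝ 2 F := by
    rw [contDiff_pi]
    rintro (i | i | i)
    · exact hg i
    · exact hh i
    · exact contDiff_apply ℝ ℝ i.1
  have hF' : HasFDerivAt F (fderiv ℝ F xs) xs :=
    (hF.differentiable (by norm_num) xs).hasFDerivAt
  have hB_g (v : Fin n → ℝ) (i : {i // g xs i = 0}) :
      fderiv ℝ F xs v (Sum.inl i) = D1 (fun x' => g x' i) xs v :=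
    (DFunLike.congr_fun (hasFDerivAt_pi'.1 hF' (Sum.inl i)).fderiv v).symm
  have hB_h (v : Fin n → ℝ) (i : Fin p) :
      fderiv ℝ F xs v (Sum.inr (Sum.inl i)) = D1 (fun x' => h x' i) xs v :=
    (DFunLike.congr_fun (hasFDerivAt_pi'.1 hF' (Sum.inr (Sum.inl i))).fderiv v).symm
  have hB_x (v : Fin n → ℝ) (i : {i // xs i = 0}) :
      fderiv ℝ F xs v (Sum.inr (Sum.inr i)) = v i :=
    DFunLike.congr_fun ((hasFDerivAt_pi'.1 hF' (Sum.inr (Sum.inr i))).unique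
      (hasFDerivAt_apply i.1 xs)) v
  have hF0 : F xs = 0 := by
    funext k
    rcases k with i | i | i
    · exact i.2
    · exact hh_zero i
    · exact i.2
  have hsurj : LinearMap.range (fderiv ℝ F xs).toLinearMap = ⊤ := by
    refine range_eq_top_of_components_independent _ fun c hc => ?_
    have hext {ι : Type} [Fintype ι] (P : ι → Prop) [DecidablePred P] (b : {i // P i} → ℝ)
        (w : ι → ℝ) :
        ∑ i, (if hi : P i then b ⟨i, hi⟩ else 0) * w i = ∑ i, b i * w i := by
      simp only [dite_mul, zero_mul]
      rw [Finset.sum_dite, Finset.sum_const_zero, add_zero]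
      exact Fintype.sum_equiv (Equiv.subtypeEquivRight (by simp)) _ _ fun i => rfl
    obtain ⟨h1, h2, h3⟩ := hlicq
      (fun i => if hi : g xs i = 0 then c (Sum.inl ⟨i, hi⟩) else 0)
      (fun i => c (Sum.inr (Sum.inl i)))
      (fun i => if hi : xs i = 0 then c (Sum.inr (Sum.inr ⟨i, hi⟩)) else 0)
      (fun i hi => dif_neg hi) (fun i hi => dif_neg hi) fun v => by
        rw [hext (fun i => g xs i = 0) (fun i => c (Sum.inl i)),
          hext (fun i => xs i = 0) (fun i => c (Sum.inr (Sum.inr i)))]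
        simpa [Fintype.sum_sum_type, hB_g, hB_h, hB_x, add_assoc] using hc v
    funext k
    rcases k with i | i | i
    · simpa [i.2] using congrFun h1 i.1
    · exact congrFun h2 i
    · simpa [i.2] using congrFun h3 i.1
  obtain ⟨ξ, hξ, hξ0, hξ', hFξ⟩ :=
    exists_curve_of_range_eq_top two_ne_zero hF.contDiffAt hF' hF0 hsurj dx
  have hinactive : ∀ᶠ t in 𝓝 (0 : ℝ), ∀ i, g xs i ≠ 0 → g (ξ t) i < 0 := by
    refine eventually_all.2 fun i => ?_
    by_cases hgi : g xs i = 0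
    · exact Eventually.of_forall fun t ht => absurd hgi ht
    · have hcont : ContinuousAt (fun t => g (ξ t) i) 0 :=
        ContinuousAt.comp (g := fun x => g x i) (hg i).continuous.continuousAt hξ.continuousAt
      have hlt : g (ξ 0) i < 0 := by rw [hξ0]; exact lt_of_le_of_ne (hg_le i) hgi
      filter_upwards [hcont.eventually (gt_mem_nhds hlt)] with t ht _ using ht
  obtain ⟨ε, hε, hball⟩ := Metric.eventually_nhds_iff_ball.1
    ((hξ.eventually (by simp)).and (hFξ.and hinactive))
  rw [Real.ball_eq_Ioo, zero_sub, zero_add] at hball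
  refine ⟨ε, hε, ξ, fun t ht => (hball t ht).1.contDiffWithinAt, hξ0, hξ', fun t ht => ?_⟩
  obtain ⟨-, hFt, hneg⟩ := hball t ⟨by linarith [ht.1], ht.2⟩
  have hgt (i : Fin m) (hi : g xs i = 0) :
      g (ξ t) i = t * D1 (fun x' => g x' i) xs dx := by
    simpa [F, hB_g] using congrFun hFt (Sum.inl ⟨i, hi⟩)
  have hht (i : Fin p) : h (ξ t) i = 0 := by
    simpa [F, hB_h, hdh] using congrFun hFt (Sum.inr (Sum.inl i))
  have hxt (i : Fin n) (hi : xs i = 0) (hy : 0 < ys i) : ξ t i = 0 := by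
    simpa [F, hB_x, hdx i hi hy] using congrFun hFt (Sum.inr (Sum.inr ⟨i, hi⟩))
  refine ⟨⟨fun i => ?_, hht, hy0, hy1, hysum, fun i => ?_⟩, fun i hi hl => ?_, hxt⟩
  · by_cases hi : g xs i = 0
    · exact (hgt i hi).trans_le (mul_nonpos_of_nonneg_of_nonpos ht.1 (hdg i hi))
    · exact (hneg i hi).le
  · rcases (hy0 i).eq_or_lt with hy | hy
    · exact mul_eq_zero_of_right _ hy.symm
    · exact mul_eq_zero_of_left (hxt i (hxs_of_pos i hy) hy) _
  · rw [hgt i hi, (mul_eq_zero.1 (hlam_dx i)).resolve_left hl.ne', mul_zero]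
end
end

section
/- Second Order Necessary Optimality Condition: Let f, g, h be twice continuously differentiable, let (x*, y*) be a local minimum of the continuous reformulation at which CC-LICQ holds, and let (λ*, μ*, γ*) be the unique S-stationary multiplier of (x*, y*). Then d_xᵀ(∇²f(x*) + Σᵢ λ*ᵢ∇²gᵢ(x*) + Σᵢ μ*ᵢ∇²hᵢ(x*))d_x ≥ 0 for all (d_x, d_y) ∈ C_Z(x*,y*). -/
open Set Filter Topology

noncomputable section

open Asymptotics in
/-- Second-order Taylor expansion with Peano remainder. -/
lemma isLittleO_taylor_two {n : ℕ} {φ : (Fin n → ℝ) → ℝ} (hφ : ContDiff ℝ 2 φ)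
    (a : Fin n → ℝ) :
    (fun x ↦ φ x - φ a - D1 φ a (x - a) - 1 / 2 * D2 φ a (x - a))
      =o[𝓝 a] fun x ↦ ‖x - a‖ ^ 2 := by
  have hd : Differentiable ℝ φ := hφ.differentiable (by norm_num)
  have hd' : Differentiable ℝ (fderiv ℝ φ) :=
    (hφ.fderiv_right (m := 1) (by norm_num)).differentiable (by norm_num)
  rw [isLittleO_iff]
  intro ε hε
  have hlo := (hd' a).hasFDerivAt.isLittleO
  obtain ⟨r, hr, hball⟩ := Metric.eventually_nhds_iff_ball.1 (hlo.def hε)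
  refine Metric.eventually_nhds_iff_ball.2 ⟨r, hr, fun x hx ↦ ?_⟩
  set v := x - a with hv
  set B := fderiv ℝ (fderiv ℝ φ) a
  have hvr : ‖v‖ < r := by rwa [Metric.mem_ball, dist_eq_norm] at hx
  let ρ : ℝ → ℝ := fun s ↦ φ (a + s • v) - s * fderiv ℝ φ a v - s ^ 2 / 2 * B v v
  have hρ (s : ℝ) : HasDerivAt ρ
      (fderiv ℝ φ (a + s • v) v - fderiv ℝ φ a v - s * B v v) s := by
    have h1 : HasDerivAt (fun s : ℝ ↦ a + s • v) v s := by
      simpa using ((hasDerivAt_id s).smul_const v).const_add a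
    have h2 := (hd (a + s • v)).hasFDerivAt.comp_hasDerivAt s h1
    have h3 := (h2.sub ((hasDerivAt_id s).mul_const (fderiv ℝ φ a v))).sub
      ((((hasDerivAt_id s).pow 2).div_const 2).mul_const (B v v))
    refine h3.congr_deriv ?_
    simp
  have hbound : ∀ s ∈ Icc (0 : ℝ) 1,
      ‖fderiv ℝ φ (a + s • v) v - fderiv ℝ φ a v - s * B v v‖ ≤ ε * ‖v‖ ^ 2 := by
    intro s hs
    have hsv : ‖s • v‖ ≤ ‖v‖ := by
      rw [norm_smul, Real.norm_of_nonneg hs.1]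
      exact mul_le_of_le_one_left (norm_nonneg v) hs.2
    have hle := hball (a + s • v) (by simpa [dist_eq_norm] using hsv.trans_lt hvr)
    rw [add_sub_cancel_left] at hle
    have heq : fderiv ℝ φ (a + s • v) v - fderiv ℝ φ a v - s * B v v
        = (fderiv ℝ φ (a + s • v) - fderiv ℝ φ a - B (s • v)) v := by simp
    rw [heq]
    calc _ ≤ ‖fderiv ℝ φ (a + s • v) - fderiv ℝ φ a - B (s • v)‖ * ‖v‖ :=
          ContinuousLinearMap.le_opNorm _ _
      _ ≤ (ε * ‖v‖) * ‖v‖ := by gcongr; exact hle.trans (by gcongr)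
      _ = ε * ‖v‖ ^ 2 := by ring
  have hmv := (convex_Icc (0 : ℝ) 1).norm_image_sub_le_of_norm_hasDerivWithin_le
    (fun s _ ↦ (hρ s).hasDerivWithinAt) hbound
    (left_mem_Icc.2 zero_le_one) (right_mem_Icc.2 zero_le_one)
  have hval : ρ 1 - ρ 0 = φ x - φ a - D1 φ a v - 1 / 2 * D2 φ a v := by
    simp only [ρ, D1, D2, iteratedFDeriv_two_apply, hv, B]
    simp
    ring
  rw [hval] at hmv
  simpa using hmv

/-- Second-order expansion along a curve differentiable at `0`. -/
lemma tendsto_second_order_along_curve {n : ℕ} {φ : (Fin n → ℝ) → ℝ} (hφ : ContDiff ℝ 2 φ)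
    {c : ℝ → Fin n → ℝ} {d : Fin n → ℝ} (hc : HasDerivAt c d 0) :
    Tendsto (fun t ↦ (φ (c t) - φ (c 0) - D1 φ (c 0) (c t - c 0)) / t ^ 2) (𝓝[>] 0)
      (𝓝 (1 / 2 * D2 φ (c 0) d)) := by
  have hslope : Tendsto (fun t : ℝ ↦ t⁻¹ • (c t - c 0)) (𝓝[>] 0) (𝓝 d) := by
    simpa using hc.tendsto_slope_zero_right
  have hrem : Tendsto (fun t : ℝ ↦ (φ (c t) - φ (c 0) - D1 φ (c 0) (c t - c 0)
      - 1 / 2 * D2 φ (c 0) (c t - c 0)) / t ^ 2) (𝓝[>] 0) (𝓝 0) := by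
    have h1 := (isLittleO_taylor_two hφ (c 0)).comp_tendsto hc.continuousAt.tendsto
    have h2 : (fun t ↦ ‖c t - c 0‖ ^ 2) =O[𝓝 0] fun t : ℝ ↦ t ^ 2 := by
      simpa using hc.isBigO_sub.norm_left.pow 2
    exact (h1.trans_isBigO h2).tendsto_div_nhds_zero.mono_left nhdsWithin_le_nhds
  have hD2 (u : Fin n → ℝ) : D2 φ (c 0) u = fderiv ℝ (fderiv ℝ φ) (c 0) u u := by
    simp [D2, iteratedFDeriv_two_apply]
  have hquad : Tendsto (fun t : ℝ ↦ D2 φ (c 0) (c t - c 0) / t ^ 2) (𝓝[>] 0)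
      (𝓝 (D2 φ (c 0) d)) := by
    have hcont : Continuous (D2 φ (c 0)) := by
      have : D2 φ (c 0) = fun u ↦ fderiv ℝ (fderiv ℝ φ) (c 0) u u := funext hD2
      rw [this]
      fun_prop
    refine (hcont.continuousAt.tendsto.comp hslope).congr fun t ↦ ?_
    simp only [Function.comp_apply, hD2, map_smul, smul_apply, smul_eq_mul]
    ring
  have := hrem.add (hquad.const_mul (1 / 2))
  rw [zero_add] at this
  refine this.congr fun t ↦ ?_
  ring

/-- Linearly independent functionals have a jointly surjective evaluation map. -/
lemma range_pi_eq_top_of_linearIndependent {E ι : Type*} [NormedAddCommGroup E]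
    [NormedSpace ℝ E] [Fintype ι] (A : ι → E →L[ℝ] ℝ)
    (hA : ∀ b : ι → ℝ, (∀ d, ∑ i, b i * A i d = 0) → b = 0) :
    (ContinuousLinearMap.pi A).range = ⊤ := by
  classical
  by_contra hne
  obtain ⟨ψ, hψ0, hψ⟩ := Submodule.exists_le_ker_of_lt_top _ (lt_top_iff_ne_top.2 hne)
  have hrep (w : ι → ℝ) : ψ w = ∑ i, ψ (Pi.single i 1) * w i := by
    conv_lhs => rw [pi_eq_sum_univ' w]
    simp [mul_comm]
  have hb := hA (fun i ↦ ψ (Pi.single i 1)) fun d ↦ by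
    have := hψ (LinearMap.mem_range_self _ d)
    rw [LinearMap.mem_ker, hrep] at this
    simpa using this
  refine hψ0 (LinearMap.ext fun w ↦ ?_)
  rw [hrep]
  simp [fun i ↦ congrFun hb i]

/-- A direction annihilated by linearly independent gradients is tangent to a curve in the
common level set. -/
lemma exists_curve_in_level_set {E ι : Type*} [NormedAddCommGroup E] [NormedSpace ℝ E]
    [CompleteSpace E] [Fintype ι] {F : ι → E → ℝ} {A : ι → E →L[ℝ] ℝ} {a : E}
    (hF : ∀ i, HasStrictFDerivAt (F i) (A i) a)
    (hA : ∀ b : ι → ℝ, (∀ d, ∑ i, b i * A i d = 0) → b = 0) {d : E} (hd : ∀ i, A i d = 0) :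
    ∃ c : ℝ → E, c 0 = a ∧ HasDerivAt c d 0 ∧ ∀ᶠ t in 𝓝 0, ∀ i, F i (c t) = F i a := by
  have hrange := range_pi_eq_top_of_linearIndependent A hA
  have hG : HasStrictFDerivAt (fun x i ↦ F i x) (ContinuousLinearMap.pi A) a :=
    hasStrictFDerivAt_pi.2 hF
  set G : E → ι → ℝ := fun x i ↦ F i x
  let k : (ContinuousLinearMap.pi A).ker := ⟨d, by
    rw [LinearMap.mem_ker]; ext i; simpa using hd i⟩
  have hline : HasDerivAt (fun t : ℝ ↦ t • k) k 0 := by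
    exact ((hasDerivAt_id (0 : ℝ)).smul_const k).congr_deriv (one_smul ℝ k)
  refine ⟨fun t ↦ hG.implicitFunction G _ hrange (G a) (t • k), ?_, ?_, ?_⟩
  · exact (congrArg _ (zero_smul ℝ k)).trans (hG.implicitFunction_apply_image hrange)
  · have h1 := (hG.to_implicitFunction hrange).hasFDerivAt
    have h2 := HasFDerivAt.comp_hasDerivAt_of_eq (0 : ℝ) h1 hline (zero_smul ℝ k).symm
    exact h2
  · have hmap := hG.map_implicitFunction_eq hrange
    have ht : Tendsto (fun t : ℝ ↦ (G a, t • k)) (𝓝 0) (𝓝 (G a, 0)) := by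
      refine tendsto_const_nhds.prodMk_nhds ?_
      exact hline.continuousAt.tendsto.trans_eq (congrArg 𝓝 (zero_smul ℝ k))
    filter_upwards [ht.eventually hmap] with t ht i
    exact congrFun ht i

lemma sum_dite_mul_eq_sum_subtype {α : Type*} [Fintype α] (P : α → Prop) [DecidablePred P]
    (b : Subtype P → ℝ) (w : α → ℝ) :
    ∑ i, (if hi : P i then b ⟨i, hi⟩ else 0) * w i = ∑ i : Subtype P, b i * w i := by
  refine (Finset.sum_of_injOn Subtype.val Subtype.val_injective.injOn (by simp) ?_ ?_).symm
  · intro i _ hi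
    have : ¬ P i := by simpa using hi
    simp [this]
  · intro i _
    simp [i.2]

/-- Under CC-LICQ, a direction `d` that is linearly feasible and vanishes on the components with
`0 < y i` is tangent to a curve along which the constraints `g i` with vanishing slope, all
constraints `h i`, and the components with `0 < y i` stay constant. -/
lemma exists_curve_of_CCLICQ {n m p : ℕ} {g : (Fin n → ℝ) → Fin m → ℝ}
    {h : (Fin n → ℝ) → Fin p → ℝ} (hg : ∀ i, ContDiff ℝ 2 (fun x ↦ g x i))
    (hh : ∀ i, ContDiff ℝ 2 (fun x ↦ h x i)) {x y d : Fin n → ℝ} (hlicq : CCLICQ g h x)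
    (hxy : ∀ i, 0 < y i → x i = 0) (hdh : ∀ i, D1 (fun x' ↦ h x' i) x d = 0)
    (hdy : ∀ i, 0 < y i → d i = 0) :
    ∃ c : ℝ → Fin n → ℝ, c 0 = x ∧ HasDerivAt c d 0 ∧
      ∀ᶠ t in 𝓝 0,
        (∀ i, g x i = 0 → D1 (fun x' ↦ g x' i) x d = 0 → g (c t) i = 0) ∧
        (∀ i, h (c t) i = h x i) ∧ ∀ i, 0 < y i → c t i = 0 := by
  classical
  let P : Fin m → Prop := fun i ↦ g x i = 0 ∧ D1 (fun x' ↦ g x' i) x d = 0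
  let Q : Fin n → Prop := fun i ↦ 0 < y i
  let F : Subtype P ⊕ Fin p ⊕ Subtype Q → (Fin n → ℝ) → ℝ :=
    Sum.elim (fun i x' ↦ g x' i) (Sum.elim (fun i x' ↦ h x' i) (fun i x' ↦ x' i))
  let A : Subtype P ⊕ Fin p ⊕ Subtype Q → (Fin n → ℝ) →L[ℝ] ℝ :=
    Sum.elim (fun i ↦ fderiv ℝ (fun x' ↦ g x' i) x)
      (Sum.elim (fun i ↦ fderiv ℝ (fun x' ↦ h x' i) x) (fun i ↦ ContinuousLinearMap.proj i.1))
  have hF : ∀ i, HasStrictFDerivAt (F i) (A i) x := by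
    rintro (i | i | i)
    · exact (hg i).contDiffAt.hasStrictFDerivAt (by norm_num)
    · exact (hh i).contDiffAt.hasStrictFDerivAt (by norm_num)
    · exact (ContinuousLinearMap.proj (R := ℝ) (φ := fun _ : Fin n ↦ ℝ) i.1).hasStrictFDerivAt
  have hA : ∀ b : Subtype P ⊕ Fin p ⊕ Subtype Q → ℝ, (∀ v, ∑ i, b i * A i v = 0) → b = 0 := by
    intro b hb
    obtain ⟨h1, h2, h3⟩ := hlicq (fun i ↦ if hi : P i then b (.inl ⟨i, hi⟩) else 0)
      (fun i ↦ b (.inr (.inl i))) (fun i ↦ if hi : Q i then b (.inr (.inr ⟨i, hi⟩)) else 0)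
      (fun i hi ↦ dif_neg fun hP ↦ hi hP.1) (fun i hi ↦ dif_neg fun hQ ↦ hi (hxy i hQ))
      fun v ↦ by
        have hbv := hb v
        rw [Fintype.sum_sum_type, Fintype.sum_sum_type, ← add_assoc] at hbv
        rw [sum_dite_mul_eq_sum_subtype P (fun i ↦ b (.inl i)),
          sum_dite_mul_eq_sum_subtype Q (fun i ↦ b (.inr (.inr i)))]
        exact hbv
    ext (i | i | i)
    · simpa [i.2] using congrFun h1 i
    · exact congrFun h2 i
    · simpa [i.2] using congrFun h3 i
  have hd : ∀ i, A i d = 0 := by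
    rintro (i | i | i)
    · exact i.2.2
    · exact hdh i
    · exact hdy i i.2
  obtain ⟨c, hc0, hc, hlevel⟩ := exists_curve_in_level_set hF hA hd
  refine ⟨c, hc0, hc, hlevel.mono fun t ht ↦ ⟨fun i hi hdi ↦ ?_, fun i ↦ ?_, fun i hi ↦ ?_⟩⟩
  · exact (ht (.inl ⟨i, hi, hdi⟩)).trans hi
  · exact ht (.inr (.inl i))
  · exact (ht (.inr (.inr ⟨i, hi⟩))).trans (hxy i hi)

/-- A function with negative derivative along a curve is eventually smaller than its initial
value. -/
lemma eventually_lt_along_curve {n : ℕ} {φ : (Fin n → ℝ) → ℝ} {c : ℝ → Fin n → ℝ}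
    {d : Fin n → ℝ} (hφ : DifferentiableAt ℝ φ (c 0)) (hc : HasDerivAt c d 0)
    (hneg : D1 φ (c 0) d < 0) : ∀ᶠ t in 𝓝[>] (0 : ℝ), φ (c t) < φ (c 0) := by
  have hslope := (hφ.hasFDerivAt.comp_hasDerivAt 0 hc).tendsto_slope_zero_right
  filter_upwards [hslope.eventually_lt_const hneg, self_mem_nhdsWithin] with t ht ht0
  have hpos : 0 < t⁻¹ := inv_pos.2 ht0
  simp only [zero_add, Function.comp_apply, smul_eq_mul] at ht
  by_contra! hle
  exact ht.not_ge (mul_nonneg hpos.le (sub_nonneg.2 hle))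

theorem stmt4
    {n m p : ℕ} (f : (Fin n → ℝ) → ℝ) (g : (Fin n → ℝ) → Fin m → ℝ)
    (h : (Fin n → ℝ) → Fin p → ℝ) (κ : ℕ)
    (hn : 0 < n) (hm : 0 < m) (hp : 0 < p) (hκ0 : 0 < κ) (hκn : κ < n)
    (hf : ContDiff ℝ 2 f) (hg : ∀ i, ContDiff ℝ 2 (fun x => g x i))
    (hh : ∀ i, ContDiff ℝ 2 (fun x => h x i))
    (xs ys : Fin n → ℝ) (hmin : LocalMinZ f g h κ (xs, ys)) (hlicq : CCLICQ g h xs)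
    (lam : Fin m → ℝ) (mu : Fin p → ℝ) (gam : Fin n → ℝ)
    (hS : IsSMult f g h xs ys lam mu gam) :
    ∀ dx dy : Fin n → ℝ, CritCone f g h κ xs ys dx dy →
      0 ≤ D2 f xs dx + ∑ i, lam i * D2 (fun x' => g x' i) xs dx
        + ∑ i, mu i * D2 (fun x' => h x' i) xs dx := by
  rintro dx dy ⟨⟨hdg, hdh, -, -, -, -, hdx0, -⟩, hdf⟩
  obtain ⟨⟨hstat, hlam, hcompl, hgam⟩, hgam0⟩ := hS
  obtain ⟨⟨hgle, hheq, hy0, hy1, hysum, hxy⟩, r, hr, hloc⟩ := hmin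
  have hx0 : ∀ i, 0 < ys i → xs i = 0 := fun i hi ↦
    (mul_eq_zero.1 (hxy i)).resolve_right hi.ne'
  have hgam_zero : ∀ i, ¬ 0 < ys i → gam i = 0 := fun i hi ↦ by
    by_cases hxi : xs i = 0
    · exact hgam0 i hxi (le_antisymm (not_lt.1 hi) (hy0 i))
    · exact hgam i hxi
  have hgam_sum : ∀ v : Fin n → ℝ, (∀ i, 0 < ys i → v i = 0) → ∑ i, gam i * v i = 0 :=
    fun v hv ↦ Finset.sum_eq_zero fun i _ ↦ by
      by_cases hi : 0 < ys i
      · rw [hv i hi, mul_zero]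
      · rw [hgam_zero i hi, zero_mul]
  have hdx : ∀ i, 0 < ys i → dx i = 0 := fun i hi ↦ hdx0 i (hx0 i hi) hi
  have hterm : ∀ i, lam i * D1 (fun x' ↦ g x' i) xs dx ≤ 0 := fun i ↦ by
    by_cases hi : g xs i = 0
    · exact mul_nonpos_of_nonneg_of_nonpos (hlam i) (hdg i hi)
    · rw [(mul_eq_zero.1 (hcompl i)).resolve_right hi, zero_mul]
  have hlam_slope : ∀ i, lam i * D1 (fun x' ↦ g x' i) xs dx = 0 := by
    have hs := hstat dx
    rw [hgam_sum dx hdx] at hs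
    simp only [hdh, mul_zero, Finset.sum_const_zero, add_zero] at hs
    have hle := Finset.sum_nonpos fun i (_ : i ∈ Finset.univ) ↦ hterm i
    exact fun i ↦ (Finset.sum_eq_zero_iff_of_nonpos fun i _ ↦ hterm i).1 (by linarith) i
      (Finset.mem_univ i)
  obtain ⟨c, rfl, hc, hlevel⟩ := exists_curve_of_CCLICQ hg hh hlicq hx0 hdh hdx
  have hlevel' := hlevel.filter_mono (nhdsWithin_le_nhds (s := Ioi (0 : ℝ)))
  have hg_le : ∀ᶠ t in 𝓝[>] (0 : ℝ), ∀ i, g (c t) i ≤ 0 := by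
    refine eventually_all.2 fun i ↦ ?_
    by_cases hi : g (c 0) i = 0
    · rcases (hdg i hi).lt_or_eq with hlt | heq
      · filter_upwards [eventually_lt_along_curve
          ((hg i).differentiable (by norm_num)).differentiableAt hc hlt] with t ht
        exact ht.le.trans hi.le
      · exact hlevel'.mono fun t ht ↦ (ht.1 i hi heq).le
    · have hcont : ContinuousAt (fun t ↦ g (c t) i) 0 :=
        ((hg i).continuous.continuousAt (x := c 0)).comp hc.continuousAt
      exact nhdsWithin_le_nhds ((hcont.eventually_lt_const
        (lt_of_le_of_ne (hgle i) hi)).mono fun t ht ↦ ht.le)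
  have hnear : ∀ᶠ t in 𝓝[>] (0 : ℝ), dist (c t) (c 0) < r :=
    nhdsWithin_le_nhds (hc.continuousAt.eventually (Metric.ball_mem_nhds _ hr))
  have hlim := ((tendsto_second_order_along_curve hf hc).add
    (tendsto_finsetSum Finset.univ fun i _ ↦
      (tendsto_second_order_along_curve (hg i) hc).const_mul (lam i))).add
    (tendsto_finsetSum Finset.univ fun i _ ↦
      (tendsto_second_order_along_curve (hh i) hc).const_mul (mu i))
  have hnonneg := ge_of_tendsto hlim (b := 0) (by
    filter_upwards [hlevel', hg_le, hnear] with t ⟨htg, hth, hty⟩ htle htr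
    have hf_le : f (c 0) ≤ f (c t) := by
      refine hloc (c t, ys) ⟨htle, fun i ↦ (hth i).trans (hheq i), hy0, hy1, hysum, fun i ↦ ?_⟩ ?_
      · rcases (hy0 i).eq_or_lt with hi | hi
        · exact mul_eq_zero_of_right _ hi.symm
        · exact mul_eq_zero_of_left (hty i hi) _
      · simpa [Prod.dist_eq, hr] using htr
    have hlam_g : ∀ i, lam i * (g (c t) i - g (c 0) i) = 0 := fun i ↦ by
      by_cases hl : lam i = 0
      · rw [hl, zero_mul]
      · have hi := (mul_eq_zero.1 (hcompl i)).resolve_left hl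
        rw [hi, htg i hi ((mul_eq_zero.1 (hlam_slope i)).resolve_left hl), sub_zero, mul_zero]
    have hs := hstat (c t - c 0)
    rw [hgam_sum (c t - c 0) fun i hi ↦ by simp [hty i hi, hx0 i hi], add_zero] at hs
    have heq : (f (c t) - f (c 0) - D1 f (c 0) (c t - c 0)) / t ^ 2
        + ∑ i, lam i * ((g (c t) i - g (c 0) i
          - D1 (fun x' ↦ g x' i) (c 0) (c t - c 0)) / t ^ 2)
        + ∑ i, mu i * ((h (c t) i - h (c 0) i
          - D1 (fun x' ↦ h x' i) (c 0) (c t - c 0)) / t ^ 2)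
        = (f (c t) - f (c 0)) / t ^ 2 := by
      simp only [mul_div_assoc', ← Finset.sum_div, ← add_div, mul_sub (lam _) (_ - _),
        hlam_g, hth, sub_self, zero_sub, mul_neg, Finset.sum_neg_distrib]
      congr 1
      linarith
    rw [heq]
    exact div_nonneg (sub_nonneg.2 hf_le) (sq_nonneg t))
  have hhalf : ∀ a b : ℝ, a * (1 / 2 * b) = 1 / 2 * (a * b) := fun a b ↦ by ring
  simp only [hhalf, ← Finset.mul_sum, ← mul_add] at hnonneg
  linarith
end
end

section
/- Let f, g, h be twice continuously differentiable, let x* be a local minimum of the cardinality constrained problem (CCP) at which CC-LICQ holds, and let (λ*, μ*, γ*) be the unique S-stationary multiplier shared by all points (x*, y) ∈ Z. Then d_xᵀ(∇²f(x*) + Σᵢ λ*ᵢ∇²gᵢ(x*) + Σᵢ μ*ᵢ∇²hᵢ(x*))d_x ≥ 0 for all d_x ∈ C_X(x*). -/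
open Set Filter Topology

noncomputable section

/-- Second-order Taylor expansion of a `C²` function. -/
theorem ContDiff.second_order_taylor_isLittleO {n : ℕ} {φ : (Fin n → ℝ) → ℝ}
    (hφ : ContDiff ℝ 2 φ) (x : Fin n → ℝ) :
    (fun v => φ (x + v) - φ x - D1 φ x v - 1 / 2 * D2 φ x v) =o[𝓝 0] fun v => ‖v‖ ^ 2 := by
  set B := fderiv ℝ (fderiv ℝ φ) x with hB
  have hsymm : ∀ v w, B v w = B w v :=
    fun v w => (hφ.contDiffAt.isSymmSndFDerivAt (by simp)) v w
  have hdiff : Differentiable ℝ (fderiv ℝ φ) :=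
    (hφ.fderiv_right (m := 1) (by norm_num)).differentiable (by norm_num)
  have hderiv : ∀ v, HasFDerivAt (fun v => φ (x + v) - φ x - D1 φ x v - 1 / 2 * D2 φ x v)
      (fderiv ℝ φ (x + v) - fderiv ℝ φ x - B v) v := by
    intro v
    have h₁ : HasFDerivAt (fun v => φ (x + v)) (fderiv ℝ φ (x + v)) v :=
      (hasFDerivAt_comp_add_left x).2 (hφ.differentiable (by norm_num) (x + v)).hasFDerivAt
    have h₂ : HasFDerivAt (fun v => D1 φ x v) (fderiv ℝ φ x) v := (fderiv ℝ φ x).hasFDerivAt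
    have h₃ : HasFDerivAt (fun v => B v v) _ v :=
      B.hasFDerivAt.clm_apply (hasFDerivAt_id v)
    have h₄ := ((h₁.sub_const (φ x)).sub h₂).sub (h₃.const_mul (1 / 2 : ℝ))
    refine (h₄.congr_fderiv ?_).congr_of_eventuallyEq (.of_forall fun w => ?_)
    · ext w
      simp [hsymm w v]
      ring
    · simp [D2, iteratedFDeriv_two_apply, hB]
  have hlin := (hasFDerivAt_iff_isLittleO_nhds_zero.1 (hdiff x).hasFDerivAt)
  refine Asymptotics.isLittleO_iff.2 fun c hc => ?_
  obtain ⟨δ, hδ, hball⟩ := Metric.eventually_nhds_iff_ball.1 (Asymptotics.isLittleO_iff.1 hlin hc)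
  filter_upwards [Metric.ball_mem_nhds 0 hδ] with v hv
  have hbound :=
    (convex_closedBall (0 : Fin n → ℝ) ‖v‖).norm_image_sub_le_of_norm_hasFDerivWithin_le
    (fun w _ => (hderiv w).hasFDerivWithinAt) (C := c * ‖v‖) (fun w hw => ?_)
    (x := 0) (y := v) (by simp) (by simp)
  · simpa [D1, D2, iteratedFDeriv_two_apply, pow_two, mul_assoc] using hbound
  · rw [mem_closedBall_zero_iff] at hw
    rw [mem_ball_zero_iff] at hv
    exact (hball w (mem_ball_zero_iff.2 (hw.trans_lt hv))).trans (by gcongr)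

theorem continuous_D2 {n : ℕ} (φ : (Fin n → ℝ) → ℝ) (x : Fin n → ℝ) :
    Continuous (D2 φ x) := by
  unfold D2
  refine (iteratedFDeriv ℝ 2 φ x).cont.comp (continuous_pi fun i => ?_)
  fin_cases i <;> exact continuous_id

theorem D2_smul {n : ℕ} (φ : (Fin n → ℝ) → ℝ) (x d : Fin n → ℝ) (t : ℝ) :
    D2 φ x (t • d) = t ^ 2 * D2 φ x d := by
  simp [D2, iteratedFDeriv_two_apply]
  ring

/-- A finite family of linearly independent functionals is jointly surjective. -/
theorem LinearIndependent.range_pi_eq_top {ι E : Type*} [Finite ι] [NormedAddCommGroup E]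
    [NormedSpace ℝ E] {c : ι → E →L[ℝ] ℝ} (hc : LinearIndependent ℝ c) :
    (ContinuousLinearMap.pi c).range = ⊤ := by
  classical
  have := Fintype.ofFinite ι
  by_contra hne
  obtain ⟨Λ, hΛ, hle⟩ := Submodule.exists_le_ker_of_lt_top _ (lt_top_iff_ne_top.2 hne)
  have hsum : ∀ w : ι → ℝ, Λ w = ∑ j, w j * Λ (Pi.single j 1) := fun w => by
    conv_lhs => rw [pi_eq_sum_univ' w]
    simp
  have hzero : ∀ j, Λ (Pi.single j 1) = 0 := by
    refine Fintype.linearIndependent_iff.1 hc (fun j => Λ (Pi.single j 1)) ?_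
    ext v
    have hv : Λ (ContinuousLinearMap.pi c v) = 0 := hle ⟨v, rfl⟩
    rw [hsum] at hv
    simpa [mul_comm] using hv
  exact hΛ (LinearMap.ext fun w => by simp [hsum w, hzero])

/-- A direction annihilated by linearly independent derivatives of constraint functions is tangent
to a curve along which these functions are constant. -/
theorem exists_curve_of_linearIndependent {ι E : Type*} [Finite ι] [NormedAddCommGroup E]
    [NormedSpace ℝ E] [CompleteSpace E] {c : ι → E → ℝ} {c' : ι → E →L[ℝ] ℝ} {x d : E}
    (hc : ∀ j, HasStrictFDerivAt (c j) (c' j) x) (hind : LinearIndependent ℝ c')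
    (hd : ∀ j, c' j d = 0) :
    ∃ γ : ℝ → E, γ 0 = x ∧ HasDerivAt γ d 0 ∧ ∀ᶠ t in 𝓝 (0 : ℝ), ∀ j, c j (γ t) = c j x := by
  have := Fintype.ofFinite ι
  have hF : HasStrictFDerivAt (fun z j => c j z) (ContinuousLinearMap.pi c') x :=
    hasStrictFDerivAt_pi.2 hc
  have hsurj := hind.range_pi_eq_top
  let k : (ContinuousLinearMap.pi c').ker := ⟨d, funext hd⟩
  have hline : HasDerivAt (fun t : ℝ => t • k) k 0 :=
    ((hasDerivAt_id (0 : ℝ)).smul_const k).congr_deriv (one_smul ℝ k)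
  refine ⟨fun t => hF.implicitFunction _ _ hsurj (fun j => c j x) (t • k), ?_, ?_, ?_⟩
  · simp only [zero_smul ℝ k]
    exact hF.implicitFunction_apply_image hsurj
  · have hto := (hF.to_implicitFunction hsurj).hasFDerivAt
    rw [← zero_smul ℝ k] at hto
    exact hto.comp_hasDerivAt 0 hline
  · have hlim : Tendsto (fun t : ℝ => ((fun j => c j x), t • k)) (𝓝 0)
        (𝓝 ((fun j => c j x), 0)) := by
      refine tendsto_const_nhds.prodMk_nhds ?_
      exact zero_smul ℝ k ▸ hline.continuousAt.tendsto
    filter_upwards [hlim.eventually (hF.map_implicitFunction_eq hsurj)] with t ht j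
    exact congrFun ht j

/-- If a quadratic form, up to an error of order `o(‖v‖ ^ 2)`, is nonnegative along the increments
of a curve, then it is nonnegative at the tangent direction of the curve. -/
theorem nonneg_of_isLittleO_along_curve {E : Type*} [NormedAddCommGroup E] [NormedSpace ℝ E]
    {Q R : E → ℝ} (hQ : Continuous Q) (hQsmul : ∀ (t : ℝ) v, Q (t • v) = t ^ 2 * Q v)
    (hR : R =o[𝓝 0] fun v => ‖v‖ ^ 2) {γ : ℝ → E} {x d : E} (h0 : γ 0 = x)
    (hγ : HasDerivAt γ d 0) (hnonneg : ∀ᶠ t in 𝓝[>] (0 : ℝ), 0 ≤ Q (γ t - x) + R (γ t - x)) :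
    0 ≤ Q d := by
  have hle : 𝓝[>] (0 : ℝ) ≤ 𝓝[≠] 0 := nhdsWithin_mono _ fun t ht => ne_of_gt ht
  have hslope : Tendsto (fun t : ℝ => t⁻¹ • (γ t - x)) (𝓝[>] 0) (𝓝 d) := by
    refine (hasDerivAt_iff_tendsto_slope.1 hγ |>.mono_left hle).congr fun t => ?_
    simp [slope_def_module, h0]
  have hincr : Tendsto (fun t : ℝ => γ t - x) (𝓝[>] 0) (𝓝 0) := by
    have := hγ.continuousAt.tendsto.sub_const x
    rw [h0, sub_self] at this
    exact this.mono_left nhdsWithin_le_nhds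
  have hbig : (fun t => ‖γ t - x‖ ^ 2) =O[𝓝[>] 0] fun t : ℝ => t ^ 2 := by
    have := (hγ.isBigO_sub.mono (nhdsWithin_le_nhds (s := Ioi 0))).norm_left.pow 2
    simpa [h0] using this
  have hrem : Tendsto (fun t : ℝ => R (γ t - x) / t ^ 2) (𝓝[>] 0) (𝓝 0) :=
    ((hR.comp_tendsto hincr).trans_isBigO hbig).tendsto_div_nhds_zero
  have hlim := ((hQ.tendsto d).comp hslope).add hrem
  rw [add_zero] at hlim
  refine ge_of_tendsto hlim ?_
  filter_upwards [hnonneg, self_mem_nhdsWithin] with t ht htpos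
  have htpos : (0 : ℝ) < t := htpos
  have hdiv := div_nonneg ht (sq_nonneg t)
  simp only [Function.comp_apply, hQsmul]
  convert hdiv using 1
  field_simp

/-- The indicator of the common zeros of `x` and a critical direction completes `x` to a feasible
point of the continuous reformulation. -/
theorem indicator_mem_ZSet {n m p : ℕ} {g : (Fin n → ℝ) → Fin m → ℝ}
    {h : (Fin n → ℝ) → Fin p → ℝ} {κ : ℕ} {x d : Fin n → ℝ}
    [DecidablePred fun i => x i = 0 ∧ d i = 0]
    (hg : ∀ i, g x i ≤ 0) (hh : ∀ i, h x i = 0)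
    (hcard : n - κ ≤ {i | x i = 0 ∧ d i = 0}.ncard) :
    (x, fun i => if x i = 0 ∧ d i = 0 then 1 else 0) ∈ ZSet g h κ := by
  refine ⟨hg, hh, fun i => ?_, fun i => ?_, ?_, fun i => ?_⟩
  · dsimp only
    split_ifs <;> norm_num
  · dsimp only
    split_ifs <;> norm_num
  · rw [← Finset.coe_filter_univ, Set.ncard_coe_finset] at hcard
    rw [Finset.sum_boole, sub_le_iff_le_add]
    exact_mod_cast Nat.sub_le_iff_le_add.1 hcard
  · dsimp only
    split_ifs with hi
    · rw [hi.1, zero_mul]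
    · rw [mul_zero]

theorem card0_le_of_vanish {n κ : ℕ} {x d z : Fin n → ℝ} (hκ : κ ≤ n)
    (hcard : n - κ ≤ {i | x i = 0 ∧ d i = 0}.ncard) (hz : ∀ i, x i = 0 → d i = 0 → z i = 0) :
    card0 z ≤ κ := by
  have hsub : {i | x i = 0 ∧ d i = 0} ⊆ {i | z i ≠ 0}ᶜ := fun i hi => by
    simpa using hz i hi.1 hi.2
  have hle := Set.ncard_le_ncard hsub (Set.toFinite _)
  have hcompl := Set.ncard_add_ncard_compl {i | z i ≠ 0}
  rw [Nat.card_fin] at hcompl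
  unfold card0
  omega

theorem eventually_neg_of_hasDerivAt_neg {φ : ℝ → ℝ} {a : ℝ} (h0 : φ 0 = 0)
    (hφ : HasDerivAt φ a 0) (ha : a < 0) : ∀ᶠ t in 𝓝[>] (0 : ℝ), φ t < 0 := by
  have hle : 𝓝[>] (0 : ℝ) ≤ 𝓝[≠] 0 := nhdsWithin_mono _ fun t ht => ne_of_gt ht
  filter_upwards [((hasDerivAt_iff_tendsto_slope.1 hφ).mono_left hle).eventually_lt_const ha,
    self_mem_nhdsWithin] with t ht htpos
  have htpos : (0 : ℝ) < t := htpos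
  rw [slope_def_field, h0, sub_zero, sub_zero, div_neg_iff] at ht
  rcases ht with ht | ht
  · exact absurd ht.2 htpos.not_gt
  · exact ht.1

theorem sum_dite_mul {ι : Type*} [Fintype ι] (P : ι → Prop) [DecidablePred P]
    (a : {i // P i} → ℝ) (w : ι → ℝ) :
    ∑ i, (if hi : P i then a ⟨i, hi⟩ else 0) * w i = ∑ i : {i // P i}, a i * w i := by
  refine (Fintype.sum_of_injective Subtype.val Subtype.val_injective _ _ (fun i hi => ?_)
    fun i => ?_).symm
  · rw [dif_neg fun hP => hi ⟨⟨i, hP⟩, rfl⟩, zero_mul]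
  · rw [dif_pos i.2]

/-- Under CC-LICQ a direction `d` in the kernel of all `∇hᵢ(x)` is tangent to a curve which keeps
`h`, the active `gᵢ` with `∇gᵢ(x)ᵀd = 0`, and the common zero components of `x` and `d` fixed. -/
theorem exists_critical_curve {n m p : ℕ} {g : (Fin n → ℝ) → Fin m → ℝ}
    {h : (Fin n → ℝ) → Fin p → ℝ} {x d : Fin n → ℝ}
    (hg : ∀ i, ContDiff ℝ 2 (fun x => g x i)) (hh : ∀ i, ContDiff ℝ 2 (fun x => h x i))
    (hlicq : CCLICQ g h x) (hd : ∀ i, D1 (fun x' => h x' i) x d = 0) :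
    ∃ γ : ℝ → Fin n → ℝ, γ 0 = x ∧ HasDerivAt γ d 0 ∧
      (∀ᶠ t in 𝓝 (0 : ℝ), ∀ i, g x i = 0 → D1 (fun x' => g x' i) x d = 0 → g (γ t) i = 0) ∧
      (∀ᶠ t in 𝓝 (0 : ℝ), ∀ i, h (γ t) i = h x i) ∧
      (∀ᶠ t in 𝓝 (0 : ℝ), ∀ i, x i = 0 → d i = 0 → γ t i = 0) := by
  classical
  let A : Fin m → Prop := fun i => g x i = 0 ∧ D1 (fun x' => g x' i) x d = 0
  let I : Fin n → Prop := fun i => x i = 0 ∧ d i = 0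
  let c : {i // A i} ⊕ Fin p ⊕ {i // I i} → (Fin n → ℝ) → ℝ :=
    Sum.elim (fun i x' => g x' i) (Sum.elim (fun i x' => h x' i) fun i x' => x' i)
  let c' : {i // A i} ⊕ Fin p ⊕ {i // I i} → (Fin n → ℝ) →L[ℝ] ℝ :=
    Sum.elim (fun i => fderiv ℝ (fun x' => g x' i) x)
      (Sum.elim (fun i => fderiv ℝ (fun x' => h x' i) x) fun i => ContinuousLinearMap.proj i.1)
  have hc : ∀ j, HasStrictFDerivAt (c j) (c' j) x := by
    rintro (i | i | i)
    · exact (hg i).contDiffAt.hasStrictFDerivAt (by norm_num)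
    · exact (hh i).contDiffAt.hasStrictFDerivAt (by norm_num)
    · exact (ContinuousLinearMap.proj (R := ℝ) (φ := fun _ : Fin n => ℝ) i.1).hasStrictFDerivAt
  have hker : ∀ j, c' j d = 0 := by
    rintro (i | i | i)
    · exact i.2.2
    · exact hd i
    · exact i.2.2
  have hind : LinearIndependent ℝ c' := by
    refine Fintype.linearIndependent_iff.2 fun a ha => ?_
    obtain ⟨hlam, hmu, hgam⟩ := hlicq
      (fun i => if hi : A i then a (.inl ⟨i, hi⟩) else 0) (fun i => a (.inr (.inl i)))
      (fun i => if hi : I i then a (.inr (.inr ⟨i, hi⟩)) else 0)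
      (fun i hi => dif_neg fun hA => hi hA.1) (fun i hi => dif_neg fun hI => hi hI.1)
      (fun v => by
        have hv := DFunLike.congr_fun ha v
        simp only [Fintype.sum_sum_type, add_apply, sum_apply, smul_apply, smul_eq_mul, c',
          Sum.elim_inl, Sum.elim_inr, ContinuousLinearMap.proj_apply,
          zero_apply] at hv
        rw [sum_dite_mul A fun i => a (.inl i), sum_dite_mul I fun i => a (.inr (.inr i)),
          add_assoc]
        exact hv)
    rintro (i | i | i)
    · simpa [i.2] using congrFun hlam i.1
    · exact congrFun hmu i
    · simpa [i.2] using congrFun hgam i.1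
  obtain ⟨γ, h0, hγ, hconst⟩ := exists_curve_of_linearIndependent hc hind hker
  exact ⟨γ, h0, hγ, hconst.mono fun t ht i hi hi' => (ht (.inl ⟨i, hi, hi'⟩)).trans hi,
    hconst.mono fun t ht i => ht (.inr (.inl i)),
    hconst.mono fun t ht i hi hi' => (ht (.inr (.inr ⟨i, hi, hi'⟩))).trans hi⟩

theorem stmt5
    {n m p : ℕ} (f : (Fin n → ℝ) → ℝ) (g : (Fin n → ℝ) → Fin m → ℝ)
    (h : (Fin n → ℝ) → Fin p → ℝ) (κ : ℕ)
    (hn : 0 < n) (hm : 0 < m) (hp : 0 < p) (hκ0 : 0 < κ) (hκn : κ < n)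
    (hf : ContDiff ℝ 2 f) (hg : ∀ i, ContDiff ℝ 2 (fun x => g x i))
    (hh : ∀ i, ContDiff ℝ 2 (fun x => h x i))
    (xs : Fin n → ℝ) (hmin : LocalMinCCP f g h κ xs) (hlicq : CCLICQ g h xs)
    (lam : Fin m → ℝ) (mu : Fin p → ℝ) (gam : Fin n → ℝ)
    (hmult : ∀ y, (xs, y) ∈ ZSet g h κ → IsSMult f g h xs y lam mu gam) :
    ∀ dx : Fin n → ℝ, CritConeX f g h κ xs dx →
      0 ≤ D2 f xs dx + ∑ i, lam i * D2 (fun x' => g x' i) xs dx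
        + ∑ i, mu i * D2 (fun x' => h x' i) xs dx := by
  classical
  rintro dx ⟨hdg, hdh, hcard, hdf⟩
  obtain ⟨⟨hgx, hhx, -⟩, r, hr, hloc⟩ := hmin
  obtain ⟨⟨hstat, hlam, hcompl, -⟩, hgam⟩ := hmult _ (indicator_mem_ZSet hgx hhx hcard)
  have hgam : ∀ i, ¬(xs i = 0 ∧ dx i = 0) → gam i = 0 := by
    intro i hi
    by_cases hx : xs i = 0
    · exact hgam i hx (if_neg hi)
    · exact (hmult _ (indicator_mem_ZSet hgx hhx hcard)).1.2.2.2 i hx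
  have hgamdx : ∑ i, gam i * dx i = 0 := by
    refine Finset.sum_eq_zero fun i _ => ?_
    by_cases hi : xs i = 0 ∧ dx i = 0
    · rw [hi.2, mul_zero]
    · rw [hgam i hi, zero_mul]
  have hterm : ∀ i, lam i * D1 (fun x' => g x' i) xs dx ≤ 0 := by
    intro i
    rcases mul_eq_zero.1 (hcompl i) with hi | hi
    · rw [hi, zero_mul]
    · exact mul_nonpos_of_nonneg_of_nonpos (hlam i) (hdg i hi)
  have hlamdx : ∀ i, lam i * D1 (fun x' => g x' i) xs dx = 0 := by
    have hsum : ∑ i, lam i * D1 (fun x' => g x' i) xs dx = 0 := by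
      refine le_antisymm (Finset.sum_nonpos fun i _ => hterm i) ?_
      have := hstat dx
      simp only [hdh, mul_zero, Finset.sum_const_zero, hgamdx] at this
      linarith
    exact fun i =>
      (Finset.sum_eq_zero_iff_of_nonpos fun i _ => hterm i).1 hsum i (Finset.mem_univ i)
  obtain ⟨γ, h0, hγ, hγg, hγh, hγx⟩ := exists_critical_curve hg hh hlicq hdh
  have hmin : ∀ᶠ t in 𝓝[>] (0 : ℝ), f xs ≤ f (γ t) := by
    have hnear : ∀ᶠ t in 𝓝 (0 : ℝ), dist (γ t) xs < r := by
      have := hγ.continuousAt.tendsto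
      rw [h0] at this
      exact this.eventually (Metric.ball_mem_nhds xs hr)
    have hgle : ∀ i, ∀ᶠ t in 𝓝[>] (0 : ℝ), g (γ t) i ≤ 0 := fun i => by
      rcases (hgx i).lt_or_eq with hi | hi
      · have hlim : Tendsto (fun t => g (γ t) i) (𝓝 0) (𝓝 (g xs i)) := by
          have := ((hg i).continuous.tendsto (γ 0)).comp hγ.continuousAt.tendsto
          rwa [h0] at this
        exact ((hlim.eventually_lt_const hi).mono fun t ht => ht.le).filter_mono nhdsWithin_le_nhds
      · rcases (hdg i hi).lt_or_eq with hi' | hi'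
        · refine (eventually_neg_of_hasDerivAt_neg (φ := fun t => g (γ t) i) (by simp [h0, hi])
            ?_ hi').mono fun t ht => ht.le
          refine HasFDerivAt.comp_hasDerivAt (0 : ℝ) (l := fun x => g x i) ?_ hγ
          rw [h0]
          exact ((hg i).differentiable (by norm_num) xs).hasFDerivAt
        · exact (hγg.filter_mono nhdsWithin_le_nhds).mono fun t ht => (ht i hi hi').le
    filter_upwards [hnear.filter_mono nhdsWithin_le_nhds, eventually_all.2 hgle,
      hγh.filter_mono nhdsWithin_le_nhds, hγx.filter_mono nhdsWithin_le_nhds] with t ht hgt hht hxt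
    refine hloc _ ⟨hgt, fun i => (hht i).trans (hhx i), ?_⟩ ht
    exact card0_le_of_vanish hκn.le hcard hxt
  let Q : (Fin n → ℝ) → ℝ := fun v => D2 f xs v + ∑ i, lam i * D2 (fun x' => g x' i) xs v
    + ∑ i, mu i * D2 (fun x' => h x' i) xs v
  let T : ((Fin n → ℝ) → ℝ) → (Fin n → ℝ) → ℝ := fun φ v =>
    φ (xs + v) - φ xs - D1 φ xs v - 1 / 2 * D2 φ xs v
  let R : (Fin n → ℝ) → ℝ := fun v => 2 * (T f v + ∑ i, lam i * T (fun x' => g x' i) v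
    + ∑ i, mu i * T (fun x' => h x' i) v)
  have hR : R =o[𝓝 0] fun v => ‖v‖ ^ 2 :=
    (((hf.second_order_taylor_isLittleO xs).add
      (Asymptotics.IsLittleO.fun_sum fun i _ =>
        ((hg i).second_order_taylor_isLittleO xs).const_mul_left (lam i))).add
      (Asymptotics.IsLittleO.fun_sum fun i _ =>
        ((hh i).second_order_taylor_isLittleO xs).const_mul_left (mu i))).const_mul_left 2
  have hQ : Continuous Q :=
    ((continuous_D2 f xs).add (continuous_finsetSum _ fun i _ =>
      (continuous_D2 _ xs).const_mul (lam i))).add (continuous_finsetSum _ fun i _ =>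
      (continuous_D2 _ xs).const_mul (mu i))
  have hQsmul : ∀ (t : ℝ) v, Q (t • v) = t ^ 2 * Q v := fun t v => by
    simp only [Q, D2_smul, mul_add, Finset.mul_sum, mul_left_comm]
  refine nonneg_of_isLittleO_along_curve hQ hQsmul hR h0 hγ ?_
  filter_upwards [hmin, hγg.filter_mono nhdsWithin_le_nhds, hγh.filter_mono nhdsWithin_le_nhds,
    hγx.filter_mono nhdsWithin_le_nhds] with t ht hgt hht hxt
  have hgv : ∑ i, lam i * (g (γ t) i - g xs i) = 0 := by
    refine Finset.sum_eq_zero fun i _ => ?_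
    rcases mul_eq_zero.1 (hcompl i) with hi | hi
    · rw [hi, zero_mul]
    · rcases mul_eq_zero.1 (hlamdx i) with hi' | hi'
      · rw [hi', zero_mul]
      · rw [hgt i hi hi', hi, sub_zero, mul_zero]
  have hgamv : ∑ i, gam i * (γ t - xs) i = 0 := by
    refine Finset.sum_eq_zero fun i _ => ?_
    by_cases hi : xs i = 0 ∧ dx i = 0
    · simp [hxt i hi.1 hi.2, hi.1]
    · rw [hgam i hi, zero_mul]
  have hlag := hstat (γ t - xs)
  rw [hgamv] at hlag
  have hgsum : ∑ i, lam i * T (fun x' => g x' i) (γ t - xs) =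
      ∑ i, lam i * (g (γ t) i - g xs i) - ∑ i, lam i * D1 (fun x' => g x' i) xs (γ t - xs)
        - 1 / 2 * ∑ i, lam i * D2 (fun x' => g x' i) xs (γ t - xs) := by
    simp only [T, add_sub_cancel, Finset.mul_sum, ← Finset.sum_sub_distrib]
    exact Finset.sum_congr rfl fun i _ => by ring
  have hhsum : ∑ i, mu i * T (fun x' => h x' i) (γ t - xs) =
      - ∑ i, mu i * D1 (fun x' => h x' i) xs (γ t - xs)
        - 1 / 2 * ∑ i, mu i * D2 (fun x' => h x' i) xs (γ t - xs) := by
    simp only [T, add_sub_cancel, Finset.mul_sum, ← Finset.sum_sub_distrib,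
      ← Finset.sum_neg_distrib, hht]
    exact Finset.sum_congr rfl fun i _ => by ring
  simp only [Q, R]
  rw [hgsum, hhsum, hgv]
  simp only [T, add_sub_cancel]
  linarith
end
end

section
/- Second Order Sufficient Optimality Condition: Let f, g, h be twice continuously differentiable and let (x*, y*) be an S-stationary point of the continuous reformulation satisfying CC-SOSC, i.e. for every (d_x, d_y) ∈ C_Z(x*,y*) with d_x ≠ 0 there exists at least one S-stationary multiplier (λ*, μ*, γ*) of (x*, y*) with d_xᵀ(∇²f(x*) + Σᵢ λ*ᵢ∇²gᵢ(x*) + Σᵢ μ*ᵢ∇²hᵢ(x*))d_x > 0. Then (x*, y*) is a strict local minimum with respect to x of the continuous reformulation. -/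
open Set Filter Topology

noncomputable section

/-- Second order Taylor expansion with Peano remainder, at a point of a real normed space. -/
theorem isLittleO_taylor_two_s6 {E F : Type*} [NormedAddCommGroup E] [NormedSpace ℝ E]
    [NormedAddCommGroup F] [NormedSpace ℝ F] {φ : E → F} (hφ : ContDiff ℝ 2 φ) (x : E) :
    (fun v => φ (x + v) - φ x - fderiv ℝ φ x v - (1 / 2 : ℝ) • fderiv ℝ (fderiv ℝ φ) x v v)
      =o[𝓝 0] fun v => ‖v‖ ^ 2 := by
  have hdiff : Differentiable ℝ φ := hφ.differentiable (by norm_num)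
  have hderiv : ContDiff ℝ 1 (fderiv ℝ φ) := hφ.fderiv_right (by norm_num)
  have hsymm : IsSymmSndFDerivAt ℝ φ x := hφ.contDiffAt.isSymmSndFDerivAt (by simp)
  set B := fderiv ℝ (fderiv ℝ φ) x with hB
  have hR : ∀ w, HasFDerivAt
      (fun v => φ (x + v) - φ x - fderiv ℝ φ x v - (1 / 2 : ℝ) • B v v)
      (fderiv ℝ φ (x + w) - fderiv ℝ φ x - B w) w := by
    intro w
    have h1 : HasFDerivAt (fun v => φ (x + v)) (fderiv ℝ φ (x + w)) w :=
      (hasFDerivAt_comp_add_left x).2 (hdiff (x + w)).hasFDerivAt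
    have h2 := (B.hasFDerivAt (x := w)).clm_apply (hasFDerivAt_id (𝕜 := ℝ) w)
    refine (((h1.sub_const (φ x)).sub (fderiv ℝ φ x).hasFDerivAt).sub
      (h2.const_smul (1 / 2 : ℝ))).congr_fderiv ?_
    ext u
    have hs : B u w = B w u := hsymm u w
    simp only [sub_apply, smul_apply, add_apply, ContinuousLinearMap.comp_apply,
      ContinuousLinearMap.flip_apply, ContinuousLinearMap.id_apply, id, hs]
    rw [← two_smul ℝ (B w u), smul_smul]
    norm_num
  have hlittle : (fun w => fderiv ℝ φ (x + w) - fderiv ℝ φ x - B w) =o[𝓝 0] fun w => w :=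
    hasFDerivAt_iff_isLittleO_nhds_zero.1 (hderiv.differentiable (by norm_num) x).hasFDerivAt
  rw [Asymptotics.isLittleO_iff] at hlittle ⊢
  intro ε hε
  obtain ⟨r, hr, hball⟩ := Metric.eventually_nhds_iff.1 (hlittle hε)
  refine Metric.eventually_nhds_iff.2 ⟨r, hr, fun v hv => ?_⟩
  rw [dist_zero_right] at hv
  have hbound : ∀ w ∈ Metric.closedBall (0 : E) ‖v‖,
      ‖fderiv ℝ φ (x + w) - fderiv ℝ φ x - B w‖ ≤ ε * ‖v‖ := by
    intro w hw
    rw [mem_closedBall_zero_iff] at hw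
    exact (hball (by rw [dist_zero_right]; exact hw.trans_lt hv)).trans
      (mul_le_mul_of_nonneg_left hw hε.le)
  have hmv := Convex.norm_image_sub_le_of_norm_hasFDerivWithin_le
    (fun w _ => (hR w).hasFDerivWithinAt) hbound (convex_closedBall (0 : E) ‖v‖)
    (x := 0) (y := v) (by simp) (by simp)
  simpa [pow_two, mul_assoc] using hmv

/-- Limit of second order difference quotients along a sequence converging in direction `d`. -/
theorem tendsto_secondOrder_quotient {n : ℕ} {φ : (Fin n → ℝ) → ℝ} (hφ : ContDiff ℝ 2 φ)
    {x d : Fin n → ℝ} {α : Type*} {l : Filter α} {c : α → ℝ} {v : α → Fin n → ℝ}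
    (hv : Tendsto v l (𝓝 0)) (hcv : Tendsto (fun k => c k • v k) l (𝓝 d)) :
    Tendsto (fun k => c k ^ 2 * (φ (x + v k) - φ x - D1 φ x (v k))) l
      (𝓝 (1 / 2 * D2 φ x d)) := by
  set B := fderiv ℝ (fderiv ℝ φ) x with hB
  have hquad : Tendsto (fun k => 1 / 2 * B (c k • v k) (c k • v k)) l (𝓝 (1 / 2 * B d d)) :=
    (((B.continuous.clm_apply continuous_id).tendsto d).comp hcv).const_mul _
  have hrem : Tendsto (fun k => c k ^ 2 *
      (φ (x + v k) - φ x - D1 φ x (v k) - 1 / 2 * B (v k) (v k))) l (𝓝 0) := by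
    have hO : (fun k => c k ^ 2 * ‖v k‖ ^ 2) =O[l] fun _ => (1 : ℝ) := by
      have h1 : Tendsto (fun k => c k ^ 2 * ‖v k‖ ^ 2) l (𝓝 (‖d‖ ^ 2)) := by
        refine (hcv.norm.pow 2).congr fun k => ?_
        rw [norm_smul, mul_pow, Real.norm_eq_abs, sq_abs]
      exact h1.isBigO_one ℝ
    have ho := (isLittleO_taylor_two_s6 hφ x).comp_tendsto hv
    exact (((Asymptotics.isBigO_refl (fun k => c k ^ 2) l).mul_isLittleO ho).trans_isBigO
      hO).tendsto_zero_of_tendsto tendsto_const_nhds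
  have hD2 : D2 φ x d = B d d := by simp [D2, hB, iteratedFDeriv_two_apply]
  have hsum := hrem.add hquad
  rw [zero_add, ← hD2] at hsum
  refine hsum.congr fun k => ?_
  simp only [map_smul, smul_apply, smul_eq_mul]
  ring

/-- Limit of first order difference quotients whose numerators are nonpositive. -/
theorem D1_nonpos_of_tendsto {n : ℕ} {φ : (Fin n → ℝ) → ℝ} {x d : Fin n → ℝ}
    (hφ : DifferentiableAt ℝ φ x) {α : Type*} {l : Filter α} [l.NeBot] {c : α → ℝ}
    {v : α → Fin n → ℝ} (hc : ∀ k, 0 ≤ c k) (hv : Tendsto v l (𝓝 0))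
    (hcv : Tendsto (fun k => c k • v k) l (𝓝 d)) (hle : ∀ k, φ (x + v k) ≤ φ x) :
    D1 φ x d ≤ 0 := by
  exact le_of_tendsto
    ((hφ.hasFDerivAt.hasFDerivWithinAt (s := univ)).lim hv (by simp) hcv)
    (Eventually.of_forall fun k => mul_nonpos_of_nonneg_of_nonpos (hc k) (sub_nonpos.2 (hle k)))

/-- A sequence of nonzero vectors has a subsequence whose normalisations converge to a nonzero
vector. -/
theorem exists_subseq_direction {E : Type*} [NormedAddCommGroup E] [NormedSpace ℝ E]
    [ProperSpace E] {v : ℕ → E} (hv0 : ∀ k, v k ≠ 0) :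
    ∃ (d : E) (s : ℕ → ℕ), d ≠ 0 ∧ StrictMono s ∧
      Tendsto (fun k => ‖v (s k)‖⁻¹ • v (s k)) atTop (𝓝 d) := by
  obtain ⟨d, hd, s, hs, hlim⟩ := (isCompact_sphere (0 : E) 1).tendsto_subseq
    (x := fun k => ‖v k‖⁻¹ • v k) fun k => by simp [norm_smul, hv0 k]
  exact ⟨d, s, ne_zero_of_mem_unit_sphere (⟨d, hd⟩ : Metric.sphere (0 : E) 1), hs, hlim⟩

theorem stmt6
    {n m p : ℕ} (f : (Fin n → ℝ) → ℝ) (g : (Fin n → ℝ) → Fin m → ℝ)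
    (h : (Fin n → ℝ) → Fin p → ℝ) (κ : ℕ)
    (hn : 0 < n) (hm : 0 < m) (hp : 0 < p) (hκ0 : 0 < κ) (hκn : κ < n)
    (hf : ContDiff ℝ 2 f) (hg : ∀ i, ContDiff ℝ 2 (fun x => g x i))
    (hh : ∀ i, ContDiff ℝ 2 (fun x => h x i))
    (xs ys : Fin n → ℝ) (hZ : (xs, ys) ∈ ZSet g h κ)
    (hstat : ∃ lam mu gam, IsSMult f g h xs ys lam mu gam)
    (hsosc : ∀ dx dy : Fin n → ℝ, CritCone f g h κ xs ys dx dy → dx ≠ 0 →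
      ∃ lam mu gam, IsSMult f g h xs ys lam mu gam ∧
        0 < D2 f xs dx + ∑ i, lam i * D2 (fun x' => g x' i) xs dx
        + ∑ i, mu i * D2 (fun x' => h x' i) xs dx) :
    StrictLocalMinX f g h κ (xs, ys) := by
  refine ⟨hZ, ?_⟩
  by_contra! hcon
  choose z hzZ hzdist hzne hzf using fun k : ℕ => hcon (1 / ((k : ℝ) + 1)) (by positivity)
  obtain ⟨hgs, hhs, hys0, -, -, -⟩ := hZ
  have hzlim : Tendsto z atTop (𝓝 (xs, ys)) :=
    tendsto_iff_dist_tendsto_zero.2 <| squeeze_zero (fun _ => dist_nonneg)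
      (fun k => (hzdist k).le) tendsto_one_div_add_atTop_nhds_zero_nat
  have hXlim : Tendsto (fun k => (z k).1 - xs) atTop (𝓝 0) := by
    simpa using ((continuous_fst.tendsto _).comp hzlim).sub_const xs
  obtain ⟨d, s, hd0, hs, hcv⟩ := exists_subseq_direction fun k => sub_ne_zero.2 (hzne k)
  set v : ℕ → Fin n → ℝ := fun k => (z (s k)).1 - xs with hv
  set c : ℕ → ℝ := fun k => ‖v k‖⁻¹
  have hc : ∀ k, 0 ≤ c k := fun k => inv_nonneg.2 (norm_nonneg _)
  change Tendsto (fun k => c k • v k) atTop (𝓝 d) at hcv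
  have hvlim : Tendsto v atTop (𝓝 0) := hXlim.comp hs.tendsto_atTop
  have hxv : ∀ k, xs + v k = (z (s k)).1 := fun k => add_sub_cancel _ _
  have hzero : ∀ i, xs i = 0 → 0 < ys i → ∀ᶠ k in atTop, v k i = 0 := by
    intro i hxi hyi
    have hlim : Tendsto (fun k => (z (s k)).2 i) atTop (𝓝 (ys i)) :=
      (((continuous_apply i).comp continuous_snd).tendsto _).comp
        (hzlim.comp hs.tendsto_atTop)
    filter_upwards [hlim.eventually (lt_mem_nhds hyi)] with k hk
    have hprod := (hzZ (s k)).2.2.2.2.2 i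
    simpa [hv, hxi] using (mul_eq_zero.1 hprod).resolve_right hk.ne'
  have hcrit : CritCone f g h κ xs ys d 0 := by
    refine ⟨⟨fun i hi => ?_, fun i => le_antisymm ?_ ?_, by simp, by simp, by simp, by simp,
      fun i hxi hyi => ?_, by simp⟩, ?_⟩
    · refine D1_nonpos_of_tendsto ((hg i).differentiable (by norm_num) xs) hc hvlim hcv fun k => ?_
      rw [hxv, hi]
      exact (hzZ (s k)).1 i
    · refine D1_nonpos_of_tendsto ((hh i).differentiable (by norm_num) xs) hc hvlim hcv fun k => ?_
      rw [hxv, (hzZ (s k)).2.1 i]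
      exact (hhs i).ge
    · have hneg := D1_nonpos_of_tendsto (φ := fun x' => -h x' i)
        ((hh i).differentiable (by norm_num) xs).neg hc hvlim hcv fun k => by
          rw [hxv, (hzZ (s k)).2.1 i]
          exact (neg_eq_zero.2 (hhs i)).ge.trans' (by simp)
      simpa [D1, fderiv_fun_neg] using hneg
    · refine tendsto_nhds_unique (((continuous_apply i).tendsto d).comp hcv)
        (tendsto_const_nhds.congr' ?_)
      filter_upwards [hzero i hxi hyi] with k hk
      simp [hk]
    · refine D1_nonpos_of_tendsto (hf.differentiable (by norm_num) xs) hc hvlim hcv fun k => ?_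
      rw [hxv]
      exact hzf (s k)
  obtain ⟨lam, mu, gam, ⟨⟨hstatL, hlam, hcompl, hgam⟩, hgam0⟩, hpos⟩ := hsosc d 0 hcrit hd0
  have hgamv : ∀ᶠ k in atTop, ∀ i, gam i * v k i = 0 := by
    refine eventually_all.2 fun i => ?_
    by_cases hxi : xs i = 0
    · rcases (hys0 i).eq_or_lt with hyi | hyi
      · simp [hgam0 i hxi hyi.symm]
      · filter_upwards [hzero i hxi hyi] with k hk
        simp [hk]
    · simp [hgam i hxi]
  have hlimL := ((tendsto_secondOrder_quotient hf (x := xs) hvlim hcv).add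
    (tendsto_finsetSum Finset.univ fun i _ =>
      (tendsto_secondOrder_quotient (hg i) (x := xs) hvlim hcv).const_mul (lam i))).add
    (tendsto_finsetSum Finset.univ fun i _ =>
      (tendsto_secondOrder_quotient (hh i) (x := xs) hvlim hcv).const_mul (mu i))
  have hle := le_of_tendsto (b := 0) hlimL <| by
    filter_upwards [hgamv] with k hk
    have hst := hstatL (v k)
    simp only [hk, Finset.sum_const_zero, add_zero] at hst
    have hfk : f (xs + v k) ≤ f xs := by rw [hxv]; exact hzf (s k)
    have hgk : ∑ i, lam i * (g (xs + v k) i - g xs i) ≤ 0 :=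
      Finset.sum_nonpos fun i _ => by
        rw [mul_sub, hcompl, sub_zero, hxv]
        exact mul_nonpos_of_nonneg_of_nonpos (hlam i) ((hzZ (s k)).1 i)
    have hhk : ∀ i, h (xs + v k) i - h xs i = 0 := fun i => by
      rw [hxv, (hzZ (s k)).2.1 i]
      simpa using hhs i
    calc _ = c k ^ 2 * ((f (xs + v k) - f xs) + ∑ i, lam i * (g (xs + v k) i - g xs i)
          - (D1 f xs (v k) + ∑ i, lam i * D1 (fun x' => g x' i) xs (v k)
            + ∑ i, mu i * D1 (fun x' => h x' i) xs (v k))) := by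
          simp only [hhk, mul_sub, mul_add, zero_sub, Finset.mul_sum,
            Finset.sum_sub_distrib, Finset.sum_neg_distrib, mul_neg, mul_left_comm (c k ^ 2)]
          ring
      _ ≤ 0 := by
          rw [hst, sub_zero]
          exact mul_nonpos_of_nonneg_of_nonpos (sq_nonneg _) (by linarith)
  simp only [mul_left_comm _ (1 / 2 : ℝ), ← Finset.mul_sum] at hle
  linarith
end
end

section
/- Let (x*, y*) ∈ Z and let (x^k, y^k) ⊆ Z be a sequence of M-stationary points of the continuous reformulation converging to (x*, y*). If CC-CPLD holds at (x*, y*), then (x*, y*) is M-stationary and one can choose a bounded sequence (λ^k, μ^k, γ^k) of M-stationary multipliers for (x^k, y^k) such that every accumulation point (λ*, μ*, γ*) of this sequence is an M-stationary multiplier of (x*, y*). -/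
open Set Filter Topology

noncomputable section

/-- Moving `c` along a nonzero direction supported in `supp c` until the first coordinate
vanishes shrinks the support and keeps nonnegative coordinates nonnegative. -/
theorem exists_add_smul_support_ssubset {ι : Type*} [Fintype ι] (c b : ι → ℝ) (hb : b ≠ 0)
    (hbc : ∀ i, c i = 0 → b i = 0) :
    ∃ t : ℝ, Function.support (c + t • b) ⊂ Function.support c ∧
      ∀ i, 0 ≤ c i → 0 ≤ (c + t • b) i := by
  classical
  obtain ⟨j, hj⟩ := Function.ne_iff.mp hb
  obtain ⟨i, hi, hmin⟩ := (Finset.univ.filter fun i => b i ≠ 0).exists_min_image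
    (fun i => |c i| / |b i|) ⟨j, by simpa using hj⟩
  replace hi : b i ≠ 0 := by simpa using hi
  refine ⟨-(c i / b i), ?_, fun k hk => ?_⟩
  · refine (Set.ssubset_iff_of_subset fun k hk => ?_).mpr ⟨i, fun h => hi (hbc i h), ?_⟩
    · intro h
      exact hk (by simp [h, hbc k h])
    · simp [hi]
  · by_cases hbk : b k = 0
    · simpa [hbk] using hk
    · have h1 := hmin k (by simpa using hbk)
      rw [le_div_iff₀ (abs_pos.mpr hbk), ← abs_div, ← abs_mul, abs_of_nonneg hk] at h1
      have h2 := le_abs_self (c i / b i * b k)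
      simp only [Pi.add_apply, Pi.smul_apply, smul_eq_mul]
      linarith

/-- `c` solves `F x + ∑ i, c i • V x i = 0`, is nonnegative on `P` and vanishes off `A x`. -/
def IsSignedMult {X W ι : Type*} [Fintype ι] [AddCommGroup W] [Module ℝ W]
    (F : X → W) (V : X → ι → W) (P : Set ι) (A : X → Set ι) (x : X) (c : ι → ℝ) : Prop :=
  F x + ∑ i, c i • V x i = 0 ∧ (∀ i ∈ P, 0 ≤ c i) ∧ ∀ i, i ∉ A x → c i = 0

/-- If a signed multiplier exists, there is one whose support indexes a linearly independent
family. -/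
theorem exists_isSignedMult_independent {X W ι : Type*} [Fintype ι] [AddCommGroup W]
    [Module ℝ W] {F : X → W} {V : X → ι → W} {P : Set ι} {A : X → Set ι} {x : X}
    (hex : ∃ c, IsSignedMult F V P A x c) :
    ∃ c, IsSignedMult F V P A x c ∧
      ∀ b : ι → ℝ, (∀ i, c i = 0 → b i = 0) → ∑ i, b i • V x i = 0 → b = 0 := by
  obtain ⟨c, hc, hmin⟩ := (measure fun c : ι → ℝ => (Function.support c).ncard).wf.has_min
    {c | IsSignedMult F V P A x c} hex
  refine ⟨c, hc, fun b hbc hsum => by_contra fun hb => ?_⟩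
  obtain ⟨t, hss, hnn⟩ := exists_add_smul_support_ssubset c b hb hbc
  refine hmin (c + t • b) ⟨?_, fun i hi => hnn i (hc.2.1 i hi), fun i hi => ?_⟩
    (Set.ncard_lt_ncard hss (Set.toFinite _))
  · have : ∑ i, (t * b i) • V x i = 0 := by
      simp only [mul_smul, ← Finset.smul_sum, hsum, smul_zero]
    simpa [add_smul, Finset.sum_add_distrib, this] using hc.1
  · have h0 := hc.2.2 i hi
    simp [h0, hbc i h0]

section Limits

variable {X W ι : Type*} [Fintype ι] [TopologicalSpace X] [NormedAddCommGroup W]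
  [NormedSpace ℝ W] {F : X → W} {V : X → ι → W} {P : Set ι} {A : X → Set ι} {a : X}

/-- Limits of signed multipliers are signed multipliers. -/
theorem IsSignedMult.of_tendsto (hF : ContinuousAt F a) (hV : ∀ i, ContinuousAt (V · i) a)
    (hA : ∀ i, ∀ᶠ x in 𝓝 a, i ∈ A x → i ∈ A a) {x : ℕ → X} (hx : Tendsto x atTop (𝓝 a))
    {c : ℕ → ι → ℝ} (hc : ∀ k, IsSignedMult F V P A (x k) (c k)) {l : ι → ℝ}
    (hl : Tendsto c atTop (𝓝 l)) : IsSignedMult F V P A a l := by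
  rw [tendsto_pi_nhds] at hl
  refine ⟨?_, fun i hi => ge_of_tendsto' (hl i) fun k => (hc k).2.1 i hi, fun i hi => ?_⟩
  · refine tendsto_nhds_unique ((hF.tendsto.comp hx).add (tendsto_finsetSum _ fun i _ =>
      (hl i).smul ((hV i).tendsto.comp hx))) ?_
    exact tendsto_const_nhds.congr fun k => ((hc k).1).symm
  · refine tendsto_nhds_unique (hl i) (tendsto_const_nhds.congr' ?_)
    filter_upwards [hx.eventually (hA i)] with k hk
    exact ((hc k).2.2 i fun h => hi (hk h)).symm

/-- Under constant positive linear dependence at the limit point, signed multipliers with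
linearly independent supports are bounded. -/
theorem bddAbove_norm_of_isSignedMult (hF : ContinuousAt F a)
    (hV : ∀ i, ContinuousAt (V · i) a) (hA : ∀ i, ∀ᶠ x in 𝓝 a, i ∈ A x → i ∈ A a)
    (hcpld : ∀ S : Set ι, S ⊆ A a →
      (∃ c : ι → ℝ, c ≠ 0 ∧ (∀ i ∈ P, 0 ≤ c i) ∧ (∀ i, i ∉ S → c i = 0) ∧
        ∑ i, c i • V a i = 0) →
      ∀ᶠ x in 𝓝 a, ∃ c : ι → ℝ, c ≠ 0 ∧ (∀ i, i ∉ S → c i = 0) ∧ ∑ i, c i • V x i = 0)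
    {x : ℕ → X} (hx : Tendsto x atTop (𝓝 a))
    {c : ℕ → ι → ℝ} (hc : ∀ k, IsSignedMult F V P A (x k) (c k))
    (hind : ∀ k, ∀ b : ι → ℝ, (∀ i, c k i = 0 → b i = 0) → ∑ i, b i • V (x k) i = 0 → b = 0) :
    BddAbove (Set.range fun k => ‖c k‖) := by
  by_contra hbd
  have hfreq : ∀ N : ℕ, ∃ᶠ k in atTop, (N : ℝ) + 1 < ‖c k‖ := fun N h => hbd <|
    Filter.IsBoundedUnder.bddAbove_range ⟨(N : ℝ) + 1, by
      rw [Filter.eventually_map]; exact h.mono fun k hk => not_lt.mp hk⟩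
  obtain ⟨φ, hφ, hlarge⟩ := extraction_forall_of_frequently hfreq
  have hpos : ∀ k, 0 < ‖c (φ k)‖ := fun k => by
    have := hlarge k; have : (0 : ℝ) ≤ k := k.cast_nonneg; linarith
  have hinv : Tendsto (fun k => ‖c (φ k)‖⁻¹) atTop (𝓝 0) :=
    tendsto_inv_atTop_zero.comp (tendsto_atTop_mono (fun k => by have := hlarge k; linarith)
      tendsto_natCast_atTop_atTop)
  obtain ⟨l, hl, ψ, hψ, hlim⟩ := (isCompact_sphere (0 : ι → ℝ) 1).tendsto_subseq
    (x := fun k => ‖c (φ k)‖⁻¹ • c (φ k)) fun k => by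
      simp [norm_smul, (hpos k).ne']
  have hxφψ : Tendsto (fun k => x (φ (ψ k))) atTop (𝓝 a) :=
    hx.comp (hφ.tendsto_atTop.comp hψ.tendsto_atTop)
  -- one support occurs infinitely often
  obtain ⟨S, hS⟩ : ∃ S : Set ι, ∃ᶠ k in atTop, Function.support (c (φ (ψ k))) = S := by
    by_contra! h
    obtain ⟨k, hk⟩ := (Filter.eventually_all.mpr h).exists
    exact hk _ rfl
  have hSA : S ⊆ A a := fun i hi => by
    obtain ⟨k, hk, hk'⟩ := (hS.and_eventually (hxφψ.eventually (hA i))).exists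
    refine hk' (by_contra fun h => ?_)
    rw [← hk] at hi
    exact hi ((hc _).2.2 i h)
  have hlim' := tendsto_pi_nhds.mp hlim
  have hdep : ∑ i, l i • V a i = 0 := by
    have h0 : Tendsto (fun k => ‖c (φ (ψ k))‖⁻¹ • F (x (φ (ψ k))) +
        ∑ i, (‖c (φ (ψ k))‖⁻¹ • c (φ (ψ k))) i • V (x (φ (ψ k))) i) atTop
        (𝓝 ((0 : ℝ) • F a + ∑ i, l i • V a i)) :=
      ((hinv.comp hψ.tendsto_atTop).smul (hF.tendsto.comp hxφψ)).add
        (tendsto_finsetSum _ fun i _ => (hlim' i).smul ((hV i).tendsto.comp hxφψ))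
    rw [zero_smul, zero_add] at h0
    refine tendsto_nhds_unique h0 (tendsto_const_nhds.congr fun k => ?_)
    simp only [Pi.smul_apply, smul_eq_mul, mul_smul, ← Finset.smul_sum, ← smul_add]
    rw [(hc _).1, smul_zero]
  have hevent := hcpld S hSA ⟨l, ?_, fun i hi => ?_, fun i hi => ?_, hdep⟩
  · obtain ⟨k, hk, b, hb0, hbS, hb⟩ := (hS.and_eventually (hxφψ.eventually hevent)).exists
    refine hb0 (hind _ b (fun i hi => hbS i ?_) hb)
    rw [← hk]
    simpa using hi
  · rintro rfl
    simp at hl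
  · exact ge_of_tendsto' (hlim' i) fun k =>
      mul_nonneg (inv_nonneg.mpr (norm_nonneg _)) ((hc _).2.1 i hi)
  · by_contra hli
    obtain ⟨k, hk, hk'⟩ := (hS.and_eventually ((hlim' i).eventually_ne hli)).exists
    rw [← hk] at hi
    exact hk' (by simp [Function.notMem_support.mp hi])

end Limits

/-- Gradients of the constraints `g`, `h` together with the coordinate functionals. -/
def constraintGrad {n m p : ℕ} (g : (Fin n → ℝ) → Fin m → ℝ) (h : (Fin n → ℝ) → Fin p → ℝ)
    (x : Fin n → ℝ) : Fin m ⊕ Fin p ⊕ Fin n → ((Fin n → ℝ) →L[ℝ] ℝ) :=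
  Sum.elim (fun i => fderiv ℝ (fun x' => g x' i) x)
    (Sum.elim (fun i => fderiv ℝ (fun x' => h x' i) x) fun i => ContinuousLinearMap.proj i)

/-- Indices of the constraints active at `x`. -/
def activeIdx {n m : ℕ} (p : ℕ) (g : (Fin n → ℝ) → Fin m → ℝ) (x : Fin n → ℝ) :
    Set (Fin m ⊕ Fin p ⊕ Fin n) :=
  {j | Sum.elim (fun i => g x i = 0) (Sum.elim (fun _ => True) fun i => x i = 0) j}

theorem sum_constraintGrad_apply {n m p : ℕ} (g : (Fin n → ℝ) → Fin m → ℝ)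
    (h : (Fin n → ℝ) → Fin p → ℝ) (x d : Fin n → ℝ) (c : Fin m ⊕ Fin p ⊕ Fin n → ℝ) :
    (∑ j, c j • constraintGrad g h x j) d =
      ∑ i, c (.inl i) * D1 (fun x' => g x' i) x d
        + ∑ i, c (.inr (.inl i)) * D1 (fun x' => h x' i) x d
        + ∑ i, c (.inr (.inr i)) * d i := by
  simp [constraintGrad, D1, Fintype.sum_sum_type, add_assoc]

theorem combZero_iff {n m p : ℕ} (g : (Fin n → ℝ) → Fin m → ℝ)
    (h : (Fin n → ℝ) → Fin p → ℝ) (x : Fin n → ℝ) (c : Fin m ⊕ Fin p ⊕ Fin n → ℝ) :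
    CombZero g h (fun i => c (.inl i)) (fun i => c (.inr (.inl i)))
      (fun i => c (.inr (.inr i))) x ↔ ∑ j, c j • constraintGrad g h x j = 0 := by
  rw [ContinuousLinearMap.ext_iff]
  simp only [sum_constraintGrad_apply, CombZero, zero_apply]

theorem isMMult_iff {n m p : ℕ} (f : (Fin n → ℝ) → ℝ) (g : (Fin n → ℝ) → Fin m → ℝ)
    (h : (Fin n → ℝ) → Fin p → ℝ) (x : Fin n → ℝ) (c : Fin m ⊕ Fin p ⊕ Fin n → ℝ) :
    IsMMult f g h x (fun i => c (.inl i)) (fun i => c (.inr (.inl i)))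
      (fun i => c (.inr (.inr i))) ↔
    IsSignedMult (fderiv ℝ f) (constraintGrad g h) (Set.range Sum.inl) (activeIdx p g) x c := by
  simp only [IsMMult, IsSignedMult, ContinuousLinearMap.ext_iff, add_apply,
    sum_constraintGrad_apply, zero_apply, Set.forall_mem_range, activeIdx,
    Set.mem_ofPred_eq, Sum.forall, Sum.elim_inl, Sum.elim_inr, not_true, false_imp_iff,
    implies_true, true_and, mul_eq_zero, or_iff_not_imp_right, D1, add_assoc]

/-- Active indices near `a` are active at `a`. -/
theorem eventually_mem_activeIdx {n m p : ℕ} {g : (Fin n → ℝ) → Fin m → ℝ}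
    (hg : ∀ i, Continuous fun x => g x i) (a : Fin n → ℝ) (j : Fin m ⊕ Fin p ⊕ Fin n) :
    ∀ᶠ x in 𝓝 a, j ∈ activeIdx p g x → j ∈ activeIdx p g a := by
  by_cases hj : j ∈ activeIdx p g a
  · exact .of_forall fun _ _ => hj
  · rcases j with i | i | i
    · filter_upwards [(hg i).continuousAt.eventually_ne hj] with x hx h using absurd h hx
    · exact absurd trivial hj
    · filter_upwards [(continuous_apply i).continuousAt.eventually_ne hj] with x hx h
        using absurd h hx

/-- `CCCPLD` phrased with a single index type. -/
theorem CCCPLD.eventually_dependent {n m p : ℕ} {g : (Fin n → ℝ) → Fin m → ℝ}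
    {h : (Fin n → ℝ) → Fin p → ℝ} {a : Fin n → ℝ} (H : CCCPLD g h a)
    (S : Set (Fin m ⊕ Fin p ⊕ Fin n)) (hS : S ⊆ activeIdx p g a)
    (hdep : ∃ c : Fin m ⊕ Fin p ⊕ Fin n → ℝ, c ≠ 0 ∧ (∀ j ∈ Set.range Sum.inl, 0 ≤ c j) ∧
      (∀ j, j ∉ S → c j = 0) ∧ ∑ j, c j • constraintGrad g h a j = 0) :
    ∀ᶠ x in 𝓝 a, ∃ c : Fin m ⊕ Fin p ⊕ Fin n → ℝ, c ≠ 0 ∧ (∀ j, j ∉ S → c j = 0) ∧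
      ∑ j, c j • constraintGrad g h x j = 0 := by
  classical
  obtain ⟨c, hc0, hcP, hcS, hc⟩ := hdep
  have key := H (Finset.univ.filter fun i => .inl i ∈ S)
    (Finset.univ.filter fun i => .inr (.inl i) ∈ S)
    (Finset.univ.filter fun i => .inr (.inr i) ∈ S)
    (fun i hi => hS (Finset.mem_filter.mp hi).2) (fun i hi => hS (Finset.mem_filter.mp hi).2)
    ⟨fun i => c (.inl i), fun i => c (.inr (.inl i)), fun i => c (.inr (.inr i)),
      fun i => hcP _ ⟨i, rfl⟩, fun i hi => hcS _ (by simpa using hi),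
      fun i hi => hcS _ (by simpa using hi), fun i hi => hcS _ (by simpa using hi),
      fun ⟨h1, h2, h3⟩ => hc0 ?_, (combZero_iff g h a c).mpr hc⟩
  · filter_upwards [key] with x ⟨lam, mu, gam, h1, h2, h3, h0, hx⟩
    refine ⟨Sum.elim lam (Sum.elim mu gam), fun he => h0 ⟨?_, ?_, ?_⟩, ?_,
      (combZero_iff g h x _).mp hx⟩
    · exact funext fun i => congrFun he (.inl i)
    · exact funext fun i => congrFun he (.inr (.inl i))
    · exact funext fun i => congrFun he (.inr (.inr i))
    · rintro (i | i | i) hi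
      · exact h1 i (by simpa using hi)
      · exact h2 i (by simpa using hi)
      · exact h3 i (by simpa using hi)
  · ext (i | i | i)
    · exact congrFun h1 i
    · exact congrFun h2 i
    · exact congrFun h3 i

theorem stmt7
    {n m p : ℕ} (f : (Fin n → ℝ) → ℝ) (g : (Fin n → ℝ) → Fin m → ℝ)
    (h : (Fin n → ℝ) → Fin p → ℝ) (κ : ℕ)
    (hn : 0 < n) (hm : 0 < m) (hp : 0 < p) (hκ0 : 0 < κ) (hκn : κ < n)
    (hf : ContDiff ℝ 1 f) (hg : ∀ i, ContDiff ℝ 1 (fun x => g x i))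
    (hh : ∀ i, ContDiff ℝ 1 (fun x => h x i))
    (xs ys : Fin n → ℝ) (hZ : (xs, ys) ∈ ZSet g h κ)
    (z : ℕ → (Fin n → ℝ) × (Fin n → ℝ))
    (hzM : ∀ k, MStationary f g h κ (z k))
    (hconv : Tendsto z atTop (nhds (xs, ys)))
    (hcpld : CCCPLD g h xs) :
    MStationary f g h κ (xs, ys) ∧
    ∃ w : ℕ → (Fin m → ℝ) × (Fin p → ℝ) × (Fin n → ℝ),
      (∀ k, IsMMult f g h (z k).1 (w k).1 (w k).2.1 (w k).2.2) ∧
      Bornology.IsBounded (Set.range w) ∧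
      ∀ (lam : Fin m → ℝ) (mu : Fin p → ℝ) (gam : Fin n → ℝ),
        (∃ φ : ℕ → ℕ, StrictMono φ ∧ Tendsto (w ∘ φ) atTop (nhds (lam, mu, gam))) →
        IsMMult f g h xs lam mu gam := by
  have hF : ContinuousAt (fderiv ℝ f) xs := (hf.continuous_fderiv one_ne_zero).continuousAt
  have hV : ∀ j, ContinuousAt (constraintGrad g h · j) xs := by
    rintro (i | i | i)
    · exact ((hg i).continuous_fderiv one_ne_zero).continuousAt
    · exact ((hh i).continuous_fderiv one_ne_zero).continuousAt
    · exact continuousAt_const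
  have hA := eventually_mem_activeIdx (p := p) (fun i => (hg i).continuous) xs
  have hx : Tendsto (fun k => (z k).1) atTop (𝓝 xs) :=
    (continuous_fst.tendsto (xs, ys)).comp hconv
  choose c hc hind using fun k => exists_isSignedMult_independent (by
    obtain ⟨-, lam, mu, gam, hk⟩ := hzM k
    exact ⟨Sum.elim lam (Sum.elim mu gam), (isMMult_iff f g h (z k).1 _).mp hk⟩)
  obtain ⟨C, hC⟩ := bddAbove_norm_of_isSignedMult hF hV hA hcpld.eventually_dependent hx hc hind
  replace hC : ∀ k, ‖c k‖ ≤ C := fun k => hC ⟨k, rfl⟩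
  have hC0 : 0 ≤ C := (norm_nonneg _).trans (hC 0)
  refine ⟨⟨hZ, ?_⟩, fun k => (fun i => c k (.inl i), fun i => c k (.inr (.inl i)),
    fun i => c k (.inr (.inr i))), fun k => (isMMult_iff f g h _ _).mpr (hc k), ?_, ?_⟩
  · obtain ⟨l, -, φ, hφ, hl⟩ := tendsto_subseq_of_bounded
      (Metric.isBounded_closedBall (x := 0) (r := C)) (x := c) fun k => by simpa using hC k
    exact ⟨_, _, _, (isMMult_iff f g h xs l).mpr
      (.of_tendsto hF hV hA (hx.comp hφ.tendsto_atTop) (fun k => hc (φ k)) hl)⟩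
  · refine isBounded_iff_forall_norm_le.mpr ⟨C, ?_⟩
    rintro _ ⟨k, rfl⟩
    have hle : ∀ j, ‖c k j‖ ≤ C := fun j => (norm_le_pi_norm (c k) j).trans (hC k)
    simp only [Prod.norm_mk, max_le_iff, pi_norm_le_iff_of_nonneg hC0]
    exact ⟨fun i => hle _, fun i => hle _, fun i => hle _⟩
  · rintro lam mu gam ⟨φ, hφ, hl⟩
    refine (isMMult_iff f g h xs (Sum.elim lam (Sum.elim mu gam))).mpr
      (.of_tendsto hF hV hA (hx.comp hφ.tendsto_atTop) (fun k => hc (φ k)) ?_)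
    obtain ⟨h1, h23⟩ := (Prod.tendsto_iff _ _).mp hl
    obtain ⟨h2, h3⟩ := (Prod.tendsto_iff _ _).mp h23
    rw [tendsto_pi_nhds] at h1 h2 h3 ⊢
    rintro (i | i | i)
    · exact h1 i
    · exact h2 i
    · exact h3 i
end
end
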